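/- Every interval in the right weak order of a Coxeter group is a semidistributive lattice; consequently, since the set Alc(P_ℋ) of alcoves in the fundamental polytope of an affine Weyl group forms an interval [e, w_max] in the right weak order, the poset of irreducible components H⁰(X̂_{W_a}) of the Shi variety (ordered componentwise on admitted vectors) is a semidistributive lattice. -/

import Mathlib

open scoped RealInnerProductSpace BigOperators

noncomputable section

abbrev V (n : ℕ) := EuclideanSpace ℝ (Fin n)

/-- The coroot `α^∨ = 2α/(α,α)`. -/
noncomputable def covec {n : ℕ} (α : V n) : V n := (2 / ⟪α, α⟫) • α

/-- `Φ` is an irreducible crystallographic root system in `ℝⁿ`. -/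
structure IsCrystRS {n : ℕ} (Φ : Finset (V n)) : Prop where
  ne_zero : ∀ α ∈ Φ, α ≠ 0
  span_top : Submodule.span ℝ (Φ : Set (V n)) = ⊤
  neg_mem : ∀ α ∈ Φ, -α ∈ Φ
  refl_mem : ∀ α ∈ Φ, ∀ β ∈ Φ, β - ⟪β, covec α⟫ • α ∈ Φ
  cryst : ∀ α ∈ Φ, ∀ β ∈ Φ, ∃ m : ℤ, ⟪β, covec α⟫ = (m : ℝ)
  irreducible : ∀ s ⊆ (Φ : Set (V n)),
    (∀ α ∈ s, ∀ β ∈ (Φ : Set (V n)) \ s, ⟪α, β⟫ = 0) → s = ∅ ∨ s = (Φ : Set (V n))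

/-- `Δ` is a simple system for the root system `Φ`. -/
structure IsSimpleSys {n : ℕ} (Φ Δ : Finset (V n)) : Prop where
  subset : Δ ⊆ Φ
  indep : LinearIndependent ℝ (fun a : (Δ : Set (V n)) => (a : V n))
  decomp : ∀ α ∈ Φ,
    (∃ c : V n → ℝ, (∀ d ∈ Δ, 0 ≤ c d) ∧ α = ∑ d ∈ Δ, c d • d) ∨
    (∃ c : V n → ℝ, (∀ d ∈ Δ, 0 ≤ c d) ∧ α = -∑ d ∈ Δ, c d • d)

/-- `α` is a positive root w.r.t. the simple system `Δ`. -/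
def IsPosRoot {n : ℕ} (Δ : Finset (V n)) (α : V n) : Prop :=
  ∃ c : V n → ℝ, (∀ d ∈ Δ, 0 ≤ c d) ∧ α = ∑ d ∈ Δ, c d • d

/-- The affine Weyl group `W_a`, generated by all affine reflections
`s_{α,k}(x) = x - (⟨x,α^∨⟩ - k)α`, as a subgroup of the isometry group of `ℝⁿ`. -/
noncomputable def affineWeyl {n : ℕ} (Φ : Finset (V n)) : Subgroup (V n ≃ᵢ V n) :=
  Subgroup.closure {f | ∃ α ∈ Φ, ∃ k : ℤ, ∀ x, f x = x - (⟪x, covec α⟫ - (k : ℝ)) • α}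

/-- The finite Weyl group `W`, generated by the linear reflections `s_{α,0}`. -/
noncomputable def finiteWeyl {n : ℕ} (Φ : Finset (V n)) : Subgroup (V n ≃ᵢ V n) :=
  Subgroup.closure {f | ∃ α ∈ Φ, ∀ x, f x = x - ⟪x, covec α⟫ • α}

instance isomAction {n : ℕ} : MulAction (V n ≃ᵢ V n) (V n) where
  smul f x := f x
  one_smul _ := rfl
  mul_smul _ _ _ := rfl

/-- The alcove region determined by a tuple of Shi coefficients. -/
def shiRegion {n : ℕ} (Plus : Finset (V n)) (k : V n → ℤ) : Set (V n) :=
  {x : V n | ∀ α ∈ Plus, (k α : ℝ) < ⟪x, covec α⟫ ∧ ⟪x, covec α⟫ < k α + 1}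

/-- An admitted vector: Shi coefficient tuple of an alcove inside the fundamental polytope. -/
def IsAdmitted {n : ℕ} (Δ Plus : Finset (V n)) (k : V n → ℤ) : Prop :=
  (shiRegion Plus k).Nonempty ∧ ∀ α ∈ Δ, k α = 0

/-- A relation `r` on `T` is (the order of) a semidistributive lattice if there are binary
`sup`/`inf` operations computing least upper bounds and greatest lower bounds for `r` and
satisfying both semidistributivity laws. -/
def IsSemidistribLattice {T : Type*} (r : T → T → Prop) : Prop :=
  ∃ sup inf : T → T → T,
    (∀ x y, r x (sup x y) ∧ r y (sup x y) ∧ ∀ z, r x z → r y z → r (sup x y) z) ∧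
    (∀ x y, r (inf x y) x ∧ r (inf x y) y ∧ ∀ z, r z x → r z y → r z (inf x y)) ∧
    (∀ x y z, sup x y = sup x z → sup x (inf y z) = sup x y) ∧
    (∀ x y z, inf x y = inf x z → inf x (sup y z) = inf x y)

/-- The right weak order of a Coxeter system: `u ≤_R v` iff `ℓ(u) + ℓ(u⁻¹v) = ℓ(v)`. -/
def weakLe {B W : Type*} [Group W] {M : CoxeterMatrix B} (cs : CoxeterSystem M W)
    (u v : W) : Prop :=
  cs.length u + cs.length (u⁻¹ * v) = cs.length v



/-! ### Part A: an abstract criterion for semidistributive lattices -/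

/-- Local condition: joins of two upper covers exist, and are locally prime. -/
def HalfCond (α : Type*) [Preorder α] : Prop :=
  ∀ m a₁ a₂ : α, m ⋖ a₁ → m ⋖ a₂ → ∃ j, IsLUB {a₁, a₂} j ∧
    ∀ m' a, m' ≤ m → m' ⋖ a → a ≤ j → a ≤ a₁ ∨ a ≤ a₂

theorem exists_cover_le {α : Type*} [Preorder α] [WellFoundedLT α] {x y : α} (h : x < y) :
    ∃ a, x ⋖ a ∧ a ≤ y := by
  obtain ⟨a, ⟨ha1, ha2⟩, hmin⟩ := WellFounded.has_min (wellFounded_lt (α := α))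
    {a | x < a ∧ a ≤ y} ⟨y, h, le_rfl⟩
  refine ⟨a, ⟨ha1, fun c hc1 hc2 => hmin c ⟨hc1, hc2.le.trans ha2⟩ hc2⟩, ha2⟩

theorem isLUB_pair_iff {α : Type*} [Preorder α] {x y j : α} :
    IsLUB {x, y} j ↔ x ≤ j ∧ y ≤ j ∧ ∀ z, x ≤ z → y ≤ z → j ≤ z := by
  simp only [IsLUB, IsLeast, upperBounds, lowerBounds, Set.mem_ofPred_eq, Set.mem_insert_iff,
    Set.mem_singleton_iff, forall_eq_or_imp, forall_eq]
  grind

theorem isGLB_pair_iff {α : Type*} [Preorder α] {x y j : α} :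
    IsGLB {x, y} j ↔ j ≤ x ∧ j ≤ y ∧ ∀ z, z ≤ x → z ≤ y → z ≤ j := by
  simp only [IsGLB, IsGreatest, upperBounds, lowerBounds, Set.mem_ofPred_eq, Set.mem_insert_iff,
    Set.mem_singleton_iff, forall_eq_or_imp, forall_eq]
  grind

theorem half_main {α : Type*} [Preorder α] [WellFoundedLT α] [WellFoundedGT α]
    (hA : HalfCond α) (m : α) : ∀ v₁ v₂ : α, m ≤ v₁ → m ≤ v₂ →
    ∃ j, IsLUB {v₁, v₂} j ∧ ∀ m' a, m' ≤ m → m' ⋖ a → a ≤ j → a ≤ v₁ ∨ a ≤ v₂ := by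
  induction m using (wellFounded_gt (α := α)).induction with
  | _ m ih =>
  intro v₁ v₂ h₁ h₂
  by_cases e₁ : v₁ ≤ m
  · exact ⟨v₂, isLUB_pair_iff.2 ⟨e₁.trans h₂, le_rfl, fun z _ h => h⟩, fun _ _ _ _ h => Or.inr h⟩
  by_cases e₂ : v₂ ≤ m
  · exact ⟨v₁, isLUB_pair_iff.2 ⟨le_rfl, e₂.trans h₁, fun z h _ => h⟩, fun _ _ _ _ h => Or.inl h⟩
  obtain ⟨a₁, c₁, l₁⟩ := exists_cover_le (lt_of_le_not_ge h₁ e₁)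
  obtain ⟨a₂, c₂, l₂⟩ := exists_cover_le (lt_of_le_not_ge h₂ e₂)
  obtain ⟨q, hq, hq'⟩ := hA m a₁ a₂ c₁ c₂
  rw [isLUB_pair_iff] at hq
  obtain ⟨p, hp, hp'⟩ := ih a₁ c₁.lt v₁ q l₁ hq.1
  rw [isLUB_pair_iff] at hp
  obtain ⟨j, hj, hj'⟩ := ih a₂ c₂.lt p v₂ (hq.2.1.trans hp.2.1) l₂
  rw [isLUB_pair_iff] at hj
  refine ⟨j, isLUB_pair_iff.2 ⟨hp.1.trans hj.1, hj.2.1, fun z hz1 hz2 => ?_⟩, ?_⟩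
  · exact hj.2.2 z (hp.2.2 z hz1 (hq.2.2 z (l₁.trans hz1) (l₂.trans hz2))) hz2
  · intro m' a hm' hc haj
    rcases hj' m' a (hm'.trans c₂.le) hc haj with h | h
    · rcases hp' m' a (hm'.trans c₁.le) hc h with h | h
      · exact Or.inl h
      · rcases hq' m' a hm' hc h with h | h
        · exact Or.inl (h.trans l₁)
        · exact Or.inr (h.trans l₂)
    · exact Or.inr h

theorem half_lub {α : Type*} [Preorder α] [OrderBot α] [WellFoundedLT α] [WellFoundedGT α]
    (hA : HalfCond α) (x y : α) : ∃ j, IsLUB {x, y} j := by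
  obtain ⟨j, hj, _⟩ := half_main hA ⊥ x y bot_le bot_le
  exact ⟨j, hj⟩

theorem half_msd {α : Type*} [Preorder α] [WellFoundedLT α] [WellFoundedGT α]
    (hA : HalfCond α) (hglb : ∀ x y : α, ∃ p, IsGLB {x, y} p)
    {x y z p j : α} (h1 : IsGLB {x, y} p) (h2 : IsGLB {x, z} p) (hj : IsLUB {y, z} j) :
    IsGLB {x, j} p := by
  rw [isGLB_pair_iff] at h1 h2 ⊢
  obtain ⟨q, hq⟩ := hglb x j
  rw [isGLB_pair_iff] at hq
  rw [isLUB_pair_iff] at hj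
  have hpq : p ≤ q := hq.2.2 p h1.1 (h1.2.1.trans hj.1)
  refine ⟨h1.1, h1.2.1.trans hj.1, fun w hw1 hw2 => (hq.2.2 w hw1 hw2).trans ?_⟩
  by_contra hqp
  obtain ⟨a, ca, la⟩ := exists_cover_le (lt_of_le_not_ge hpq hqp)
  obtain ⟨j', hj', hp'⟩ := half_main hA p y z h1.2.1 h2.2.1
  rw [isLUB_pair_iff] at hj'
  have haj : a ≤ j' := (la.trans hq.2.1).trans (hj.2.2 j' hj'.1 hj'.2.1)
  have hax : a ≤ x := la.trans hq.1
  rcases hp' p a le_rfl ca haj with h | h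
  · exact ca.lt.not_ge (h1.2.2 a hax h)
  · exact ca.lt.not_ge (h2.2.2 a hax h)

/-- Transfer to `IsSemidistribLattice`. -/
theorem semidistrib_of_half {α : Type*} [Preorder α] [BoundedOrder α]
    [WellFoundedLT α] [WellFoundedGT α] (hA : HalfCond α) (hA' : HalfCond αᵒᵈ)
    {T : Type*} (r : T → T → Prop) (f : T → α) (g : α → T)
    (hr : ∀ x y, r x y ↔ f x ≤ f y) (hfg : ∀ q, f (g q) ≤ q) (hfg' : ∀ q, q ≤ f (g q))
    (hg : ∀ p q, p ≤ q → q ≤ p → g p = g q) : IsSemidistribLattice r := by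
  have hl : ∀ x y : α, ∃ j, IsLUB {x, y} j := half_lub hA
  have hm : ∀ x y : α, ∃ j, IsGLB {x, y} j := fun x y => by
    obtain ⟨j, hj⟩ := half_lub hA' (OrderDual.toDual x) (OrderDual.toDual y)
    rw [isLUB_pair_iff] at hj
    exact ⟨OrderDual.ofDual j, isGLB_pair_iff.2 ⟨hj.1, hj.2.1, fun z h1 h2 =>
      hj.2.2 (OrderDual.toDual z) h1 h2⟩⟩
  have hmsd : ∀ x y z p j : α, IsGLB {x, y} p → IsGLB {x, z} p → IsLUB {y, z} j →
    IsGLB {x, j} p := fun x y z p j => half_msd hA hm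
  have hjsd : ∀ x y z p j : α, IsLUB {x, y} p → IsLUB {x, z} p → IsGLB {y, z} j →
    IsLUB {x, j} p := fun x y z p j h1 h2 h3 =>
    half_msd (α := αᵒᵈ) hA' hl h1 h2 h3
  choose S hS using hl
  choose I hI using hm
  simp only [isLUB_pair_iff] at hS hjsd hmsd
  simp only [isGLB_pair_iff] at hI hjsd hmsd
  refine ⟨fun x y => g (S (f x) (f y)), fun x y => g (I (f x) (f y)), ?_, ?_, ?_, ?_⟩
  · intro x y
    simp only [hr]
    exact ⟨(hS _ _).1.trans (hfg' _), (hS _ _).2.1.trans (hfg' _), fun z h1 h2 =>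
      (hfg _).trans ((hS _ _).2.2 _ h1 h2)⟩
  · intro x y
    simp only [hr]
    exact ⟨(hfg _).trans (hI _ _).1, (hfg _).trans (hI _ _).2.1, fun z h1 h2 =>
      ((hI _ _).2.2 _ h1 h2).trans (hfg' _)⟩
  · intro x y z h
    have e1 : S (f x) (f y) ≤ S (f x) (f z) := by
      have := congrArg f h
      exact (hfg' _).trans (this.le.trans (hfg _))
    have e2 : S (f x) (f z) ≤ S (f x) (f y) := by
      have := congrArg f h
      exact (hfg' _).trans (this.ge.trans (hfg _))
    have key := hjsd (f x) (f y) (f z) (S (f x) (f y)) (I (f y) (f z)) (hS _ _)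
      ⟨(hS _ _).1, (hS _ _).2.1.trans e2, fun w h1 h2 => e1.trans ((hS _ _).2.2 w h1 h2)⟩ (hI _ _)
    apply hg
    · exact (hS _ _).2.2 _ key.1 ((hfg _).trans key.2.1)
    · exact key.2.2 _ (hS _ _).1 ((hfg' _).trans (hS _ _).2.1)
  · intro x y z h
    have e1 : I (f x) (f y) ≤ I (f x) (f z) := by
      have := congrArg f h
      exact (hfg' _).trans (this.le.trans (hfg _))
    have e2 : I (f x) (f z) ≤ I (f x) (f y) := by
      have := congrArg f h
      exact (hfg' _).trans (this.ge.trans (hfg _))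
    have key := hmsd (f x) (f y) (f z) (I (f x) (f y)) (S (f y) (f z)) (hI _ _)
      ⟨(hI _ _).1, e1.trans (hI _ _).2.1, fun w h1 h2 => ((hI _ _).2.2 w h1 h2).trans e2⟩ (hS _ _)
    apply hg
    · exact key.2.2 _ (hI _ _).1 ((hI _ _).2.1.trans (hfg _))
    · exact (hI _ _).2.2 _ key.1 (key.2.1.trans (hfg' _))

theorem HalfCond.of_orderIso {α β : Type*} [Preorder α] [Preorder β] (e : α ≃o β)
    (h : HalfCond β) : HalfCond α := by
  intro m a₁ a₂ h₁ h₂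
  obtain ⟨j, hj, hj'⟩ := h (e m) (e a₁) (e a₂) ((apply_covBy_apply_iff e).2 h₁)
    ((apply_covBy_apply_iff e).2 h₂)
  rw [isLUB_pair_iff] at hj
  refine ⟨e.symm j, isLUB_pair_iff.2 ⟨?_, ?_, ?_⟩, ?_⟩
  · rw [e.le_symm_apply]; exact hj.1
  · rw [e.le_symm_apply]; exact hj.2.1
  · intro z h1 h2
    rw [e.symm_apply_le]
    exact hj.2.2 _ (e.le_iff_le.2 h1) (e.le_iff_le.2 h2)
  · intro m' a h1 h2 h3
    rw [e.le_symm_apply] at h3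
    simpa using hj' (e m') (e a) (e.le_iff_le.2 h1) ((apply_covBy_apply_iff e).2 h2) h3


/-! ### Part B: Coxeter groups -/

section CoxeterPart

theorem end_mul_app {X : Type*} (f g : Function.End X) (x : X) : (f * g) x = f (g x) := rfl

variable {B W : Type*} [Group W] {M : CoxeterMatrix B} (cs : CoxeterSystem M W)

open Classical in
/-- The action of a simple reflection on `W × ZMod 2` (reflection cocycle). -/
def cocStep (i : B) : Function.End (W × ZMod 2) := fun p =>
  (cs.simple i * p.1 * cs.simple i, p.2 + if p.1 = cs.simple i then 1 else 0)

theorem simple_conj_pow (i j : B) (k : ℕ) :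
    cs.simple j * (cs.simple i * cs.simple j) ^ k * cs.simple j =
      ((cs.simple i * cs.simple j) ^ k)⁻¹ := by
  have h : cs.simple j * (cs.simple i * cs.simple j) * (cs.simple j)⁻¹ =
    (cs.simple i * cs.simple j)⁻¹ := by simp [mul_assoc]
  rw [← inv_pow, ← h, conj_pow]
  simp

open Classical in
theorem cocStep_pow (i j : B) (k : ℕ) (t : W) (ε : ZMod 2) :
    ((cocStep cs i * cocStep cs j) ^ k) (t, ε) =
      ((cs.simple i * cs.simple j) ^ k * t * ((cs.simple i * cs.simple j) ^ k)⁻¹,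
        ε + ∑ q ∈ Finset.range (2 * k),
          if t = ((cs.simple i * cs.simple j) ^ q)⁻¹ * cs.simple j then 1 else 0) := by
  induction k with
  | zero => simp [Function.End.one_def]
  | succ k ih =>
    rw [pow_succ', end_mul_app, ih, end_mul_app, show 2 * (k + 1) = 2 * k + 1 + 1 by ring, Finset.sum_range_succ,
      Finset.sum_range_succ]
    set c := cs.simple i * cs.simple j with hc
    have hsj : ∀ q, cs.simple j * c ^ q * cs.simple j = (c ^ q)⁻¹ := simple_conj_pow cs i j
    have hsj' : ∀ q, cs.simple j * c ^ q  = (c ^ q)⁻¹ * cs.simple j := fun q => by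
      rw [← hsj q]; simp [mul_assoc]
    have e1 : (c ^ k * t * (c ^ k)⁻¹ = cs.simple j) ↔ t = (c ^ (2 * k))⁻¹ * cs.simple j := by
      rw [mul_inv_eq_iff_eq_mul, hsj' k, ← eq_inv_mul_iff_mul_eq, two_mul, pow_add, mul_inv_rev,
        mul_assoc]
    have e2 : (cs.simple j * (c ^ k * t * (c ^ k)⁻¹) * cs.simple j = cs.simple i) ↔
        t = (c ^ (2 * k + 1))⁻¹ * cs.simple j := by
      have : cs.simple j * cs.simple i * cs.simple j = c⁻¹ * cs.simple j := by simp [hc]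
      constructor
      · intro h
        have h2 : c ^ k * t * (c ^ k)⁻¹ = c⁻¹ * cs.simple j := by
          rw [← this, ← h]; simp [mul_assoc]
        rw [mul_inv_eq_iff_eq_mul, mul_assoc, hsj' k, ← eq_inv_mul_iff_mul_eq] at h2
        rw [h2, show 2 * k + 1 = k + 1 + k by ring, pow_add, pow_succ]
        simp [mul_assoc]
      · intro h
        have h2 : c ^ k * t * (c ^ k)⁻¹ = c⁻¹ * cs.simple j := by
          rw [mul_inv_eq_iff_eq_mul, mul_assoc, hsj' k, ← eq_inv_mul_iff_mul_eq, h,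
            show 2 * k + 1 = k + 1 + k by ring, pow_add, pow_succ]
          simp [mul_assoc]
        rw [h2, ← this]; simp [mul_assoc]
    simp only [cocStep, e1, e2]
    refine Prod.ext ?_ ?_
    · simp only [pow_succ', hc, mul_inv_rev, CoxeterSystem.inv_simple, mul_assoc]
    · simp only [add_assoc]

theorem cocStep_liftable : M.IsLiftable (cocStep cs) := by
  classical
  intro i j
  funext ⟨t, ε⟩
  rw [cocStep_pow, cs.simple_mul_simple_pow]
  have : ∑ q ∈ Finset.range (2 * M i j),
      (if t = ((cs.simple i * cs.simple j) ^ q)⁻¹ * cs.simple j then (1 : ZMod 2) else 0) = 0 := by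
    rw [two_mul, Finset.sum_range_add]
    simp only [pow_add, cs.simple_mul_simple_pow, one_mul]
    exact CharTwo.add_self_eq_zero _
  simp [this, Function.End.one_def]

/-- The reflection cocycle homomorphism. -/
def cocHom : W →* Function.End (W × ZMod 2) := cs.lift ⟨cocStep cs, cocStep_liftable cs⟩

open Classical in
theorem cocHom_wordProd (ω : List B) (t : W) :
    cocHom cs (cs.wordProd ω) (t, 0) =
      (cs.wordProd ω * t * (cs.wordProd ω)⁻¹, ((cs.rightInvSeq ω).count t : ZMod 2)) := by
  induction ω with
  | nil => simp [Function.End.one_def]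
  | cons i ω ih =>
    rw [cs.wordProd_cons, map_mul, end_mul_app, ih]
    have : cocHom cs (cs.simple i) = cocStep cs i := cs.lift_apply_simple _ i
    rw [this]
    have e : (cs.wordProd ω * t * (cs.wordProd ω)⁻¹ = cs.simple i) ↔
        ((cs.wordProd ω)⁻¹ * cs.simple i * cs.wordProd ω = t) := by
      constructor <;> rintro h <;> rw [← h] <;> group
    simp only [cocStep, CoxeterSystem.rightInvSeq, List.count_cons, beq_iff_eq, e]
    refine Prod.ext ?_ ?_
    · simp [mul_assoc]
    · push_cast; rfl

/-- Right exchange. -/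
theorem mem_rightInvSeq_of_descent {ω : List B} {i : B}
    (h : cs.length (cs.wordProd ω * cs.simple i) < cs.length (cs.wordProd ω)) :
    cs.simple i ∈ cs.rightInvSeq ω := by
  classical
  obtain ⟨ω', hω', hw⟩ := cs.exists_isReduced (cs.wordProd ω * cs.simple i)
  have h1 : cs.wordProd ω = cs.wordProd (ω'.concat i) := by
    rw [cs.wordProd_concat, ← hw]; simp
  have hlen := cs.length_mul_simple (cs.wordProd ω) i
  have hred : cs.IsReduced (ω'.concat i) := by
    unfold CoxeterSystem.IsReduced at hω' ⊢
    rw [← h1]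
    rw [← hw] at hω'
    simp
    omega
  have hnd := hred.nodup_rightInvSeq
  have hmem : cs.simple i ∈ cs.rightInvSeq (ω'.concat i) := by
    rw [cs.rightInvSeq_concat]; simp
  have h2 := cocHom_wordProd cs ω (cs.simple i)
  have h3 := cocHom_wordProd cs (ω'.concat i) (cs.simple i)
  rw [← h1, List.count_eq_one_of_mem hnd hmem, h2] at h3
  have h4 := congrArg Prod.snd h3
  by_contra hn
  rw [List.count_eq_zero_of_not_mem hn] at h4
  simp at h4

/-- Left exchange property. -/
theorem left_exchange {ω : List B} {i : B}
    (h : cs.length (cs.simple i * cs.wordProd ω) < cs.length (cs.wordProd ω)) :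
    ∃ j < ω.length, cs.simple i * cs.wordProd ω = cs.wordProd (ω.eraseIdx j) := by
  have h1 : cs.simple i ∈ cs.rightInvSeq ω.reverse := by
    apply mem_rightInvSeq_of_descent
    rw [cs.wordProd_reverse, cs.length_inv, ← cs.length_inv]
    simpa using h
  rw [cs.rightInvSeq_reverse, List.mem_reverse] at h1
  obtain ⟨j, hj, e⟩ := List.mem_iff_getElem.mp h1
  refine ⟨j, by simpa using hj, ?_⟩
  rw [← cs.getD_leftInvSeq_mul_wordProd, List.getD_eq_getElem _ 1 hj, e]

theorem left_exchange_append {ω₁ ω₂ : List B} {i : B}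
    (h : cs.length (cs.simple i * (cs.wordProd ω₁ * cs.wordProd ω₂)) <
      cs.length (cs.wordProd ω₁ * cs.wordProd ω₂)) :
    (∃ j < ω₁.length, cs.simple i * cs.wordProd ω₁ = cs.wordProd (ω₁.eraseIdx j)) ∨
    (∃ j < ω₂.length, cs.simple i * (cs.wordProd ω₁ * cs.wordProd ω₂) =
      cs.wordProd ω₁ * cs.wordProd (ω₂.eraseIdx j)) := by
  rw [← cs.wordProd_append] at h
  obtain ⟨j, hj, e⟩ := left_exchange cs h
  by_cases hj1 : j < ω₁.length
  · left
    refine ⟨j, hj1, ?_⟩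
    rw [List.eraseIdx_append_of_lt_length hj1, cs.wordProd_append, cs.wordProd_append,
      ← mul_assoc] at e
    exact mul_right_cancel e
  · right
    rw [List.length_append] at hj
    refine ⟨j - ω₁.length, by omega, ?_⟩
    rw [List.eraseIdx_append_of_length_le (by omega), cs.wordProd_append, cs.wordProd_append] at e
    exact e


theorem weakLe_refl (u : W) : weakLe cs u u := by simp [weakLe]

theorem weakLe_trans {u v w : W} (h1 : weakLe cs u v) (h2 : weakLe cs v w) : weakLe cs u w := by
  unfold weakLe at *
  have a := cs.length_mul_le (u⁻¹ * v) (v⁻¹ * w)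
  have b := cs.length_mul_le u (u⁻¹ * w)
  have e1 : u⁻¹ * v * (v⁻¹ * w) = u⁻¹ * w := by group
  have e2 : u * (u⁻¹ * w) = w := by group
  rw [e1] at a
  rw [e2] at b
  omega

theorem weakLe_antisymm {u v : W} (h1 : weakLe cs u v) (h2 : weakLe cs v u) : u = v := by
  unfold weakLe at *
  have : cs.length (u⁻¹ * v) = 0 := by omega
  rw [cs.length_eq_zero_iff] at this
  exact inv_mul_eq_one.mp this

theorem weakLe_iff_translate {m x z : W} (hx : weakLe cs m x) (hz : weakLe cs m z) :
    weakLe cs x z ↔ weakLe cs (m⁻¹ * x) (m⁻¹ * z) := by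
  unfold weakLe at *
  have e : (m⁻¹ * x)⁻¹ * (m⁻¹ * z) = x⁻¹ * z := by group
  rw [e]
  omega

theorem weakLe_translate {m u z : W} (hz : weakLe cs m z) (hu : weakLe cs u (m⁻¹ * z)) :
    cs.length (m * u) = cs.length m + cs.length u ∧ weakLe cs m (m * u) ∧
      weakLe cs (m * u) z := by
  unfold weakLe at *
  have a := cs.length_mul_le m u
  have b := cs.length_mul_le (m * u) ((m * u)⁻¹ * z)
  have e1 : m * u * ((m * u)⁻¹ * z) = z := by group
  have e2 : u⁻¹ * (m⁻¹ * z) = (m * u)⁻¹ * z := by group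
  have e3 : m⁻¹ * (m * u) = u := by group
  rw [e1] at b
  rw [e2] at hu
  rw [e3]
  omega

theorem simple_weakLe_iff {i : B} {w : W} :
    weakLe cs (cs.simple i) w ↔ cs.length (cs.simple i * w) < cs.length w := by
  unfold weakLe
  rw [cs.length_simple, cs.inv_simple]
  have := cs.length_simple_mul w i
  omega

theorem exists_simple_step {x y : W} (h : weakLe cs x y) (hne : x ≠ y) :
    ∃ i, cs.length (x * cs.simple i) = cs.length x + 1 ∧ weakLe cs x (x * cs.simple i) ∧
      weakLe cs (x * cs.simple i) y := by
  have hne' : x⁻¹ * y ≠ 1 := fun h => hne (inv_mul_eq_one.mp h)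
  obtain ⟨i, hi⟩ := cs.exists_leftDescent_of_ne_one hne'
  have := weakLe_translate cs h ((simple_weakLe_iff cs).2 hi)
  rw [cs.length_simple] at this
  exact ⟨i, this⟩

theorem exists_reduced_sub (I : Set B) (ω : List B) (hω : ∀ i ∈ ω, i ∈ I) :
    ∃ ω' : List B, (∀ i ∈ ω', i ∈ I) ∧ cs.IsReduced ω' ∧ cs.wordProd ω = cs.wordProd ω' := by
  induction ω with
  | nil => exact ⟨[], by simp, by simp [CoxeterSystem.IsReduced], rfl⟩
  | cons i ω ih =>
    obtain ⟨ω', h1, h2, h3⟩ := ih (fun k hk => hω k (List.mem_cons_of_mem _ hk))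
    have hi : i ∈ I := hω i (by simp)
    rcases cs.length_simple_mul (cs.wordProd ω') i with h | h
    · refine ⟨i :: ω', ?_, ?_, ?_⟩
      · intro k hk
        rcases List.mem_cons.1 hk with rfl | hk
        · exact hi
        · exact h1 k hk
      · unfold CoxeterSystem.IsReduced at *
        rw [cs.wordProd_cons, h, h2]; simp
      · rw [cs.wordProd_cons, cs.wordProd_cons, h3]
    · obtain ⟨j, hj, e⟩ := left_exchange cs (ω := ω') (i := i) (by omega)
      refine ⟨ω'.eraseIdx j, fun k hk => h1 k (List.mem_of_mem_eraseIdx hk), ?_, ?_⟩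
      · unfold CoxeterSystem.IsReduced at *
        rw [← e]
        have := List.length_eraseIdx_add_one hj
        omega
      · rw [cs.wordProd_cons, h3, e]

theorem weakLe_of_descents (I : Set B) {z : W} (hz : ∀ i ∈ I, weakLe cs (cs.simple i) z)
    (ω : List B) (hω : ∀ i ∈ ω, i ∈ I) : weakLe cs (cs.wordProd ω) z := by
  obtain ⟨ω', h1, h2, h3⟩ := exists_reduced_sub cs I ω hω
  rw [h3]
  clear h3 hω ω
  induction ω' with
  | nil => simp [weakLe]
  | cons i ω ih =>
    have hr : cs.IsReduced ω := by simpa using h2.drop 1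
    have hle := ih (fun k hk => h1 k (List.mem_cons_of_mem _ hk)) hr
    have hi := (simple_weakLe_iff cs).1 (hz i (h1 i (by simp)))
    obtain ⟨ω₂, hω₂, e₂⟩ := cs.exists_isReduced ((cs.wordProd ω)⁻¹ * z)
    have ez : z = cs.wordProd ω * cs.wordProd ω₂ := by rw [← e₂]; group
    unfold CoxeterSystem.IsReduced at *
    rw [cs.wordProd_cons] at h2 ⊢
    rw [List.length_cons] at h2
    have hle' := hle
    unfold weakLe at hle ⊢
    rw [e₂] at hle
    rcases left_exchange_append cs (ω₁ := ω) (ω₂ := ω₂) (i := i) (by rw [← ez]; exact hi) with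
      ⟨j, hj, e⟩ | ⟨j, hj, e⟩
    · have := cs.length_wordProd_le (ω.eraseIdx j)
      have h4 := List.length_eraseIdx_add_one hj
      rw [← e] at this
      omega
    · rw [← ez] at e
      have e3 : (cs.simple i * cs.wordProd ω)⁻¹ * z = cs.wordProd (ω₂.eraseIdx j) := by
        rw [mul_inv_rev, cs.inv_simple, mul_assoc, e]; group
      have := cs.length_wordProd_le (ω₂.eraseIdx j)
      have h4 := List.length_eraseIdx_add_one hj
      have b := cs.length_mul_le (cs.simple i * cs.wordProd ω) ((cs.simple i * cs.wordProd ω)⁻¹ * z)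
      rw [mul_inv_cancel_left] at b
      rw [e3] at b ⊢
      omega

theorem exists_longest (I : Set B) {z : W} (hz : ∀ i ∈ I, weakLe cs (cs.simple i) z) :
    ∃ υ : List B, (∀ i ∈ υ, i ∈ I) ∧ ∀ i ∈ I, weakLe cs (cs.simple i) (cs.wordProd υ) := by
  let S : Set ℕ := {k | ∃ ω : List B, (∀ i ∈ ω, i ∈ I) ∧ k = cs.length (cs.wordProd ω)}
  have hne : S.Nonempty := ⟨0, [], by simp, by simp⟩
  have hb : BddAbove S := by
    refine ⟨cs.length z, ?_⟩
    rintro k ⟨ω, hω, rfl⟩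
    have := weakLe_of_descents cs I hz ω hω
    unfold weakLe at this
    omega
  obtain ⟨υ, h1, h2⟩ := Nat.sSup_mem hne hb
  refine ⟨υ, h1, fun i hi => ?_⟩
  rw [simple_weakLe_iff]
  have h3 : cs.length (cs.wordProd (i :: υ)) ≤ sSup S := by
    apply le_csSup hb
    refine ⟨i :: υ, ?_, rfl⟩
    intro k hk
    rcases List.mem_cons.1 hk with rfl | hk
    · exact hi
    · exact h1 k hk
  rw [cs.wordProd_cons] at h3
  have := cs.length_simple_mul (cs.wordProd υ) i
  omega

/-- Intervals of the weak order. -/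
def Ivl (a b : W) : Type _ := {w : W // weakLe cs a w ∧ weakLe cs w b}

instance (a b : W) : Preorder (Ivl cs a b) where
  le u v := weakLe cs u.1 v.1
  le_refl u := weakLe_refl cs u.1
  le_trans _ _ _ := weakLe_trans cs

theorem Ivl.le_def {a b : W} {u v : Ivl cs a b} : u ≤ v ↔ weakLe cs u.1 v.1 := Iff.rfl

theorem Ivl.length_lt {a b : W} {u v : Ivl cs a b} (h : u < v) :
    cs.length u.1 < cs.length v.1 := by
  obtain ⟨h1, h2⟩ := lt_iff_le_not_ge.1 h
  rw [Ivl.le_def] at h1 h2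
  by_contra hc
  apply h2
  have : cs.length (u.1⁻¹ * v.1) = 0 := by unfold weakLe at h1; omega
  rw [cs.length_eq_zero_iff, inv_mul_eq_one] at this
  rw [this]
  exact weakLe_refl cs _

theorem Ivl.wfLT (a b : W) : WellFoundedLT (Ivl cs a b) :=
  ⟨Subrelation.wf (fun h => Ivl.length_lt cs h) (measure fun u : Ivl cs a b => cs.length u.1).wf⟩

theorem Ivl.wfGT (a b : W) : WellFoundedGT (Ivl cs a b) :=
  ⟨Subrelation.wf (fun {x y} h => by
    have h1 := Ivl.length_lt cs h
    have h2 := x.2.2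
    unfold weakLe at h2
    change cs.length b - cs.length x.1 < cs.length b - cs.length y.1
    omega)
    (measure fun u : Ivl cs a b => cs.length b - cs.length u.1).wf⟩

theorem Ivl.cover {a b : W} {u v : Ivl cs a b} (h : u ⋖ v) :
    ∃ i, v.1 = u.1 * cs.simple i ∧ cs.length v.1 = cs.length u.1 + 1 := by
  have hne : u.1 ≠ v.1 := fun e => by
    have := Ivl.length_lt cs h.lt
    rw [e] at this
    omega
  obtain ⟨i, h1, h2, h3⟩ := exists_simple_step cs h.le hne
  let c : Ivl cs a b := ⟨u.1 * cs.simple i, weakLe_trans cs u.2.1 h2, weakLe_trans cs h3 v.2.2⟩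
  have hc : u < c := by
    refine lt_of_le_not_ge h2 fun h' => ?_
    have : c.1 = u.1 := weakLe_antisymm cs h' h2
    have := congrArg cs.length this
    change cs.length (u.1 * cs.simple i) = _ at this
    omega
  have h4 : v ≤ c := by
    by_contra h'
    exact h.2 hc (lt_of_le_not_ge h3 h')
  have h5 : v.1 = u.1 * cs.simple i := weakLe_antisymm cs h4 h3
  exact ⟨i, h5, by rw [h5, h1]⟩

theorem Ivl.halfCond (a b : W) : HalfCond (Ivl cs a b) := by
  intro m a₁ a₂ c₁ c₂
  obtain ⟨i₁, e₁, l₁⟩ := Ivl.cover cs c₁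
  obtain ⟨i₂, e₂, l₂⟩ := Ivl.cover cs c₂
  have tr : ∀ {z : W} {i : B} {v : Ivl cs a b}, v.1 = m.1 * cs.simple i → m ≤ v →
      weakLe cs v.1 z → weakLe cs (cs.simple i) (m.1⁻¹ * z) := by
    intro z i v hv hmv hvz
    have := (weakLe_iff_translate cs hmv (weakLe_trans cs hmv hvz)).1 hvz
    rwa [hv, inv_mul_cancel_left] at this
  have hI : ∀ z : W, weakLe cs a₁.1 z → weakLe cs a₂.1 z →
      ∀ i ∈ ({i₁, i₂} : Set B), weakLe cs (cs.simple i) (m.1⁻¹ * z) := by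
    rintro z h1 h2 i (rfl | rfl)
    · exact tr e₁ c₁.le h1
    · exact tr e₂ c₂.le h2
  obtain ⟨υ, hυ, hυ'⟩ := exists_longest cs {i₁, i₂} (hI b a₁.2.2 a₂.2.2)
  have hle : ∀ z : W, weakLe cs a₁.1 z → weakLe cs a₂.1 z →
      weakLe cs (cs.wordProd υ) (m.1⁻¹ * z) := fun z h1 h2 =>
    weakLe_of_descents cs _ (hI z h1 h2) υ hυ
  obtain ⟨lj, hmj, hjb⟩ := weakLe_translate cs m.2.2 (hle b a₁.2.2 a₂.2.2)
  let j : Ivl cs a b := ⟨m.1 * cs.wordProd υ, weakLe_trans cs m.2.1 hmj, hjb⟩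
  have haj : ∀ {i : B} {v : Ivl cs a b}, i ∈ ({i₁, i₂} : Set B) → v.1 = m.1 * cs.simple i →
      v ≤ j := by
    intro i v hi hv
    have h1 : weakLe cs (cs.simple i) (m.1⁻¹ * (m.1 * cs.wordProd υ)) := by
      rw [inv_mul_cancel_left]; exact hυ' i hi
    have := (weakLe_translate cs hmj h1).2.2
    rw [← hv] at this
    exact this
  refine ⟨j, isLUB_pair_iff.2 ⟨haj (by simp) e₁, haj (by simp) e₂, fun z h1 h2 => ?_⟩, ?_⟩
  · exact (weakLe_translate cs (weakLe_trans cs c₁.le h1) (hle z.1 h1 h2)).2.2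
  · intro m' v hm' cv hvj
    obtain ⟨i, ev, lv⟩ := Ivl.cover cs cv
    by_cases hs : weakLe cs (cs.simple i) (m'.1⁻¹ * m.1)
    · left
      have := (weakLe_translate cs hm' hs).2.2
      rw [← ev] at this
      exact weakLe_trans cs this c₁.le
    · obtain ⟨μ, hμ⟩ : ∃ μ, μ = m'.1⁻¹ * m.1 := ⟨_, rfl⟩
      rw [← hμ] at hs
      have hm'j : weakLe cs m'.1 j.1 := weakLe_trans cs hm' hmj
      have h1 : weakLe cs (cs.simple i) (μ * cs.wordProd υ) := by
        have := (weakLe_iff_translate cs cv.le hm'j).1 hvj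
        rw [ev, inv_mul_cancel_left] at this
        rw [hμ, mul_assoc]
        exact this
      have hμj : weakLe cs μ (μ * cs.wordProd υ) := by
        have := (weakLe_iff_translate cs hm' hm'j).1 hmj
        rw [hμ, mul_assoc]
        exact this
      obtain ⟨ω, hω, eω⟩ := cs.exists_isReduced μ
      rw [simple_weakLe_iff] at h1 hs
      rw [eω] at h1
      have hs' := cs.length_simple_mul μ i
      have key : ∃ k ∈ ({i₁, i₂} : Set B), cs.simple i * μ = μ * cs.simple k := by
        rcases left_exchange_append cs h1 with ⟨q, hq, e⟩ | ⟨q, hq, e⟩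
        · exfalso
          have h2 := cs.length_wordProd_le (ω.eraseIdx q)
          have h4 := List.length_eraseIdx_add_one hq
          unfold CoxeterSystem.IsReduced at hω
          rw [← e, ← eω] at h2
          rw [← eω] at hω
          omega
        · rw [← eω] at e
          set g := cs.wordProd (υ.eraseIdx q ++ υ.reverse) with hg
          have hgI : ∀ k ∈ υ.eraseIdx q ++ υ.reverse, k ∈ ({i₁, i₂} : Set B) := by
            intro k hk
            rcases List.mem_append.1 hk with hk | hk
            · exact hυ k (List.mem_of_mem_eraseIdx hk)
            · exact hυ k (List.mem_reverse.1 hk)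
          have e2 : cs.simple i * μ = μ * g := by
            rw [hg, cs.wordProd_append, cs.wordProd_reverse, ← mul_assoc, ← e, mul_assoc, mul_assoc,
              mul_inv_cancel, mul_one]
          have hgu : weakLe cs g (μ⁻¹ * (μ * cs.wordProd υ)) := by
            rw [inv_mul_cancel_left]
            exact weakLe_of_descents cs _ hυ' _ hgI
          have h5 := (weakLe_translate cs hμj hgu).1
          rw [← e2] at h5
          obtain ⟨γ, hγ1, hγ2, hγ3⟩ := exists_reduced_sub cs _ _ hgI
          rw [← hg] at hγ3
          unfold CoxeterSystem.IsReduced at hγ2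
          rw [← hγ3] at hγ2
          have h6 : γ.length = 1 := by omega
          obtain ⟨k, rfl⟩ := List.length_eq_one_iff.1 h6
          refine ⟨k, hγ1 k (by simp), ?_⟩
          rw [e2, hγ3, cs.wordProd_singleton]
      obtain ⟨k, hk, ek⟩ := key
      have fin : ∀ {w : Ivl cs a b}, w.1 = m.1 * cs.simple k → cs.length w.1 = cs.length m.1 + 1 →
          v ≤ w := by
        intro w ew lw
        rw [Ivl.le_def]
        have e3 : v.1⁻¹ * w.1 = μ := by
          rw [ev, ew, mul_inv_rev, cs.inv_simple]
          have : cs.simple i * m'.1⁻¹ * (m.1 * cs.simple k) = cs.simple i * (μ * cs.simple k) := by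
            rw [hμ]; group
          rw [this, ← ek, ← mul_assoc, cs.simple_mul_simple_self, one_mul]
        have h7 : weakLe cs m'.1 m.1 := hm'
        unfold weakLe at h7 ⊢
        rw [e3]
        rw [← hμ] at h7
        omega
      rcases hk with rfl | rfl
      · exact Or.inl (fin e₁ l₁)
      · exact Or.inr (fin e₂ l₂)

theorem Ivl.dual_iff {b z z' : W} (h : weakLe cs z b) (h' : weakLe cs z' b) :
    weakLe cs z z' ↔ weakLe cs (b⁻¹ * z') (b⁻¹ * z) := by
  unfold weakLe at *
  have e1 : cs.length (b⁻¹ * z) = cs.length (z⁻¹ * b) := by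
    rw [← cs.length_inv]; congr 1; group
  have e2 : cs.length (b⁻¹ * z') = cs.length (z'⁻¹ * b) := by
    rw [← cs.length_inv]; congr 1; group
  have e3 : cs.length ((b⁻¹ * z')⁻¹ * (b⁻¹ * z)) = cs.length (z⁻¹ * z') := by
    rw [← cs.length_inv]; congr 1; group
  rw [e1, e2, e3]
  omega

theorem weakLe_one (w : W) : weakLe cs 1 w := by simp [weakLe]

/-- Intervals are dual to intervals. -/
def Ivl.dualIso (a b : W) (hab : weakLe cs a b) :
    (Ivl cs a b)ᵒᵈ ≃o Ivl cs 1 (b⁻¹ * a) where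
  toFun u := ⟨b⁻¹ * (OrderDual.ofDual u).1, weakLe_one cs _,
    (Ivl.dual_iff cs hab (OrderDual.ofDual u).2.2).1 (OrderDual.ofDual u).2.1⟩
  invFun v := OrderDual.toDual ⟨b * v.1, by
    have hb : weakLe cs (b * v.1) b := by
      have h1 : weakLe cs (b⁻¹ * b) v.1 := by rw [inv_mul_cancel]; exact weakLe_one cs _
      have h2 := v.2.2
      unfold weakLe at *
      have e1 : cs.length (b⁻¹ * a) = cs.length (a⁻¹ * b) := by
        rw [← cs.length_inv]; congr 1; group
      have e2 : cs.length ((b * v.1)⁻¹ * b) = cs.length v.1 := by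
        rw [← cs.length_inv]; congr 1; group
      have e3 : (b * v.1)⁻¹ * a = v.1⁻¹ * (b⁻¹ * a) := by group
      have t1 := cs.length_mul_le a (v.1⁻¹ * (b⁻¹ * a))⁻¹
      have t2 := cs.length_mul_le (b * v.1) ((b * v.1)⁻¹ * b)
      have t3 : a * (v.1⁻¹ * (b⁻¹ * a))⁻¹ = b * v.1 := by group
      rw [t3, cs.length_inv] at t1
      rw [mul_inv_cancel_left] at t2
      omega
    refine ⟨?_, hb⟩
    rw [Ivl.dual_iff cs hab hb, inv_mul_cancel_left]
    exact v.2.2⟩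
  left_inv u := by
    apply Subtype.ext
    exact mul_inv_cancel_left _ _
  right_inv v := by
    apply Subtype.ext
    exact inv_mul_cancel_left _ _
  map_rel_iff' {u v} := (Ivl.dual_iff cs (OrderDual.ofDual v).2.2 (OrderDual.ofDual u).2.2).symm

theorem weak_interval_semidistrib (a b : W) (hab : weakLe cs a b) :
    IsSemidistribLattice
      (fun u v : {w : W // weakLe cs a w ∧ weakLe cs w b} => weakLe cs u.1 v.1) := by
  have := Ivl.wfLT cs a b
  have := Ivl.wfGT cs a b
  let _ : BoundedOrder (Ivl cs a b) :=
    { top := ⟨b, hab, weakLe_refl cs b⟩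
      le_top := fun u => u.2.2
      bot := ⟨a, weakLe_refl cs a, hab⟩
      bot_le := fun u => u.2.1 }
  refine semidistrib_of_half (α := Ivl cs a b) (Ivl.halfCond cs a b)
    ((Ivl.halfCond cs 1 (b⁻¹ * a)).of_orderIso (Ivl.dualIso cs a b hab)) _
    (fun u => u) (fun u => u) (fun _ _ => Iff.rfl) (fun _ => le_refl _) (fun _ => le_refl _) ?_
  intro p q h1 h2
  exact Subtype.ext (weakLe_antisymm cs h1 h2)

end CoxeterPart


/-! ### Part C: alcove geometry -/

section Geometry

variable {n : ℕ}

/-- The affine functions `x ↦ ⟪x, β⟫ - k`. -/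
def hyp (Ψ : Finset (V n)) : Set (V n → ℝ) :=
  {h | ∃ β ∈ Ψ, ∃ k : ℤ, h = fun x => ⟪x, β⟫ - (k : ℝ)}

/-- Slope of an affine function in the direction `v`. -/
def slp (v : V n) (h : V n → ℝ) : ℝ := h v - h 0

/-- Data of a reduced crystallographic system with an integral height vector. -/
structure GeoData (Ψ : Finset (V n)) (v : V n) : Prop where
  neg : ∀ β ∈ Ψ, -β ∈ Ψ
  refl : ∀ β ∈ Ψ, ∀ γ ∈ Ψ, ∃ k : ℤ, ⟪γ, covec β⟫ = (k : ℝ) ∧ γ - (k : ℝ) • β ∈ Ψ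
  reduced : ∀ β ∈ Ψ, ∀ γ ∈ Ψ, ∀ c : ℝ, γ = c • β → γ = β ∨ γ = -β
  vint : ∀ β ∈ Ψ, ∃ k : ℤ, ⟪v, β⟫ = (k : ℝ)
  vne : ∀ β ∈ Ψ, ⟪v, β⟫ ≠ 0

/-- Points on no hyperplane. -/
def Gen (Ψ : Finset (V n)) (x : V n) : Prop := ∀ h ∈ hyp Ψ, h x ≠ 0

/-- `h` is a facet of the region of `x`. -/
def Facet (Ψ : Finset (V n)) (x : V n) (h : V n → ℝ) : Prop :=
  ∃ p, h p = 0 ∧ ∀ g ∈ hyp Ψ, g ≠ h → g ≠ -h → 0 < g p * g x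

/-- The separation order. -/
def PLe (Ψ : Finset (V n)) (v : V n) (x y : V n) : Prop :=
  ∀ h ∈ hyp Ψ, 0 < slp v h → 0 < h x → 0 < h y

theorem slp_mk (v β : V n) (k : ℤ) : slp v (fun x => ⟪x, β⟫ - (k : ℝ)) = ⟪v, β⟫ := by
  simp [slp]

theorem slp_neg (v : V n) (h : V n → ℝ) : slp v (-h) = -slp v h := by
  simp [slp]; ring

theorem slp_comb (v : V n) {g h₁ h₂ : V n → ℝ} {c₁ c₂ : ℝ} (e : g = c₁ • h₁ + c₂ • h₂) :
    slp v g = c₁ * slp v h₁ + c₂ * slp v h₂ := by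
  subst e; simp [slp]; ring

variable {Ψ : Finset (V n)} {v : V n}

theorem hyp_neg (D : GeoData Ψ v) {h : V n → ℝ} (hh : h ∈ hyp Ψ) : -h ∈ hyp Ψ := by
  obtain ⟨β, hβ, k, rfl⟩ := hh
  refine ⟨-β, D.neg β hβ, -k, ?_⟩
  funext x
  simp
  ring

theorem slp_ne (D : GeoData Ψ v) {h : V n → ℝ} (hh : h ∈ hyp Ψ) : slp v h ≠ 0 := by
  obtain ⟨β, hβ, k, rfl⟩ := hh
  rw [slp_mk]
  exact D.vne β hβ

theorem exists_refl (D : GeoData Ψ v) {h : V n → ℝ} (hh : h ∈ hyp Ψ) :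
    ∃ s : V n → V n, (∀ x, s (s x) = x) ∧ (∀ x, h x = 0 → s x = x) ∧ h ∘ s = -h ∧
      ∀ g ∈ hyp Ψ, g ∘ s ∈ hyp Ψ ∧ ∃ c : ℝ, g ∘ s = g - c • h := by
  obtain ⟨β, hβ, k, rfl⟩ := hh
  have hβ0 : β ≠ 0 := fun e => D.vne β hβ (by simp [e])
  have h2 : ⟪covec β, β⟫ = 2 := by
    rw [covec, real_inner_smul_left]
    have : ⟪β, β⟫ ≠ 0 := by simpa using hβ0
    field_simp
  have key : ∀ (γ : V n) (l : ℝ) (x : V n), ⟪x - (⟪x, β⟫ - (k : ℝ)) • covec β, γ⟫ - l =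
      (⟪x, γ⟫ - l) - ⟪γ, covec β⟫ * (⟪x, β⟫ - (k : ℝ)) := by
    intro γ l x
    rw [inner_sub_left, real_inner_smul_left, real_inner_comm γ (covec β)]
    ring
  have hneg : ∀ x : V n, ⟪x - (⟪x, β⟫ - (k : ℝ)) • covec β, β⟫ - (k : ℝ) = -(⟪x, β⟫ - (k : ℝ)) := by
    intro x
    rw [key, real_inner_comm (covec β) β, h2]; ring
  refine ⟨fun x => x - (⟪x, β⟫ - (k : ℝ)) • covec β, ?_, ?_, ?_, ?_⟩
  · intro x
    simp only []
    rw [hneg x, neg_smul, sub_neg_eq_add, sub_add_cancel]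
  · intro x hx
    simp only [] at hx ⊢
    rw [hx]; simp
  · funext x
    exact hneg x
  · rintro g ⟨γ, hγ, l, rfl⟩
    obtain ⟨c, hc, hc'⟩ := D.refl β hβ γ hγ
    refine ⟨⟨γ - (c : ℝ) • β, hc', l - c * k, ?_⟩, c, ?_⟩
    · funext x
      change ⟪x - (⟪x, β⟫ - (k : ℝ)) • covec β, γ⟫ - (l : ℝ) = _
      rw [key, hc, inner_sub_right, real_inner_smul_right]
      push_cast
      ring
    · funext x
      change ⟪x - (⟪x, β⟫ - (k : ℝ)) • covec β, γ⟫ - (l : ℝ) = _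
      rw [key, hc]
      simp

theorem neg_comp_eq {h : V n → ℝ} {s : V n → V n} : (-h) ∘ s = -(h ∘ s) := rfl

theorem comp_inv_eq {s : V n → V n} (hs : ∀ x, s (s x) = x) (g : V n → ℝ) : (g ∘ s) ∘ s = g := by
  funext x; simp [hs]

theorem comp_cancel {s : V n → V n} (hs : ∀ x, s (s x) = x) {g h : V n → ℝ}
    (e : g ∘ s = h) : g = h ∘ s := by
  rw [← e, comp_inv_eq hs]

theorem facet_flip {x : V n} {h : V n → ℝ} (hF : Facet Ψ x h) {s : V n → V n}
    (hs : ∀ x, s (s x) = x) (hfix : ∀ x, h x = 0 → s x = x) (hhs : h ∘ s = -h)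
    (hcl : ∀ g ∈ hyp Ψ, g ∘ s ∈ hyp Ψ) :
    ∀ g ∈ hyp Ψ, g ≠ h → g ≠ -h → 0 < g x * g (s x) := by
  obtain ⟨p, hp, hp'⟩ := hF
  intro g hg h1 h2
  have e1 := hp' g hg h1 h2
  have e2 := hp' (g ∘ s) (hcl g hg)
    (fun e => h2 (by rw [comp_cancel hs e, hhs]))
    (fun e => h1 (by rw [comp_cancel hs e, neg_comp_eq, hhs, neg_neg]))
  simp only [Function.comp, hfix p hp] at e2
  have h3 : 0 < (g p * g x) * (g p * g (s x)) := mul_pos e1 e2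
  have h4 : (g p * g x) * (g p * g (s x)) = (g p) ^ 2 * (g x * g (s x)) := by ring
  rw [h4] at h3
  exact (pos_iff_pos_of_mul_pos h3).1 (lt_of_le_of_ne (sq_nonneg _) (fun e => by
    rw [← e] at h3; simp at h3))

theorem facet_transport {x : V n} {g : V n → ℝ} (hF : Facet Ψ x g) {s : V n → V n}
    (hs : ∀ x, s (s x) = x) (hcl : ∀ g ∈ hyp Ψ, g ∘ s ∈ hyp Ψ) :
    Facet Ψ (s x) (g ∘ s) := by
  obtain ⟨p, hp, hp'⟩ := hF
  refine ⟨s p, by simp [hs, hp], fun k hk h1 h2 => ?_⟩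
  exact hp' (k ∘ s) (hcl k hk) (fun e => h1 (comp_cancel hs e))
    (fun e => h2 (by rw [comp_cancel hs e]; rfl))

theorem same_sign {x : V n} {h₁ h₂ g : V n → ℝ} (m₁ : h₁ ∈ hyp Ψ) (m₂ : h₂ ∈ hyp Ψ)
    (F₁ : Facet Ψ x h₁) (F₂ : Facet Ψ x h₂)
    (n₁ : h₁ x < 0) (n₂ : h₂ x < 0) (hne : h₁ ≠ h₂) (hg : g ∈ hyp Ψ) {c₁ c₂ : ℝ}
    (e : g = c₁ • h₁ + c₂ • h₂) : (0 ≤ c₁ ∧ 0 ≤ c₂) ∨ (c₁ ≤ 0 ∧ c₂ ≤ 0) := by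
  obtain ⟨p₁, z₁, hp₁⟩ := F₁
  obtain ⟨p₂, z₂, hp₂⟩ := F₂
  have hne' : ∀ {f g : V n → ℝ}, f x < 0 → g x < 0 → f ≠ -g := by
    intro f g hf hg e
    rw [e] at hf
    simp at hf
    linarith
  have a₁ : h₂ p₁ < 0 := by
    have := hp₁ h₂ m₂ hne.symm (hne' n₂ n₁)
    nlinarith
  have a₂ : h₁ p₂ < 0 := by
    have := hp₂ h₁ m₁ hne (hne' n₁ n₂)
    nlinarith
  have v₁ : g p₁ = c₂ * h₂ p₁ := by rw [e]; simp [z₁]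
  have v₂ : g p₂ = c₁ * h₁ p₂ := by rw [e]; simp [z₂]
  by_contra hc
  have hc1 : c₁ ≠ 0 := by
    rintro rfl
    rcases le_total 0 c₂ with h | h <;> simp_all
  have hc2 : c₂ ≠ 0 := by
    rintro rfl
    rcases le_total 0 c₁ with h | h <;> simp_all
  have hop : c₁ * c₂ < 0 := by
    rcases lt_or_gt_of_ne hc1 with h | h <;> rcases lt_or_gt_of_ne hc2 with h' | h'
    · exact absurd (Or.inr ⟨h.le, h'.le⟩) hc
    · exact mul_neg_of_neg_of_pos h h'
    · exact mul_neg_of_pos_of_neg h h'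
    · exact absurd (Or.inl ⟨h.le, h'.le⟩) hc
  have w₁ : g p₁ ≠ 0 := by rw [v₁]; exact mul_ne_zero hc2 a₁.ne
  have w₂ : g p₂ ≠ 0 := by rw [v₂]; exact mul_ne_zero hc1 a₂.ne
  have q₁ := hp₁ g hg (fun e => w₁ (by rw [e, z₁])) (fun e => w₁ (by rw [e]; simp [z₁]))
  have q₂ := hp₂ g hg (fun e => w₂ (by rw [e, z₂])) (fun e => w₂ (by rw [e]; simp [z₂]))
  have q₃ : 0 < g p₁ * g p₂ := by
    have := mul_pos q₁ q₂
    have e3 : g p₁ * g x * (g p₂ * g x) = (g x) ^ 2 * (g p₁ * g p₂) := by ring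
    rw [e3] at this
    by_contra h
    nlinarith [sq_nonneg (g x)]
  rw [v₁, v₂] at q₃
  have : 0 < h₂ p₁ * h₁ p₂ := mul_pos_of_neg_of_neg a₁ a₂
  nlinarith

theorem sep_finite (Ψ : Finset (V n)) (v x y : V n) :
    {h | h ∈ hyp Ψ ∧ 0 < slp v h ∧ h x < 0 ∧ 0 < h y}.Finite := by
  have : (⋃ β ∈ Ψ, (fun (k : ℤ) => (fun x => ⟪x, β⟫ - (k : ℝ) : V n → ℝ)) ''
      (Set.Icc ⌊⟪x, β⟫⌋ ⌈⟪y, β⟫⌉)).Finite := by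
    apply Set.Finite.biUnion (Finset.finite_toSet Ψ)
    intro β _
    exact (Set.finite_Icc _ _).image _
  refine this.subset ?_
  rintro h ⟨⟨β, hβ, k, rfl⟩, -, h1, h2⟩
  simp only [] at h1 h2
  refine Set.mem_biUnion hβ ⟨k, ⟨?_, ?_⟩, rfl⟩
  · have : (⌊⟪x, β⟫⌋ : ℝ) ≤ k := (Int.floor_le _).trans (by linarith)
    exact_mod_cast this
  · have : (k : ℝ) ≤ ⌈⟪y, β⟫⌉ := le_trans (by linarith) (Int.le_ceil _)
    exact_mod_cast this

theorem perturb {T : Set (V n → ℝ)} (hT : T.Finite) (hc : ∀ G ∈ T, Continuous G)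
    (hd : ∀ G ∈ T, ∀ U : Set (V n), IsOpen U → U.Nonempty → ∃ x ∈ U, G x ≠ 0) :
    ∀ U : Set (V n), IsOpen U → U.Nonempty → ∃ x ∈ U, ∀ G ∈ T, G x ≠ 0 := by
  induction T, hT using Set.Finite.induction_on with
  | empty => intro U _ ⟨x, hx⟩; exact ⟨x, hx, by simp⟩
  | @insert G T _ _ ih =>
    intro U hU hne
    obtain ⟨x, hx, hGx⟩ := hd G (Set.mem_insert _ _) U hU hne
    have hO : IsOpen (U ∩ {x | G x ≠ 0}) :=
      hU.inter (isOpen_ne_fun (hc G (Set.mem_insert _ _)) continuous_const)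
    obtain ⟨x', hx', h'⟩ := ih (fun G hG => hc G (Set.mem_insert_of_mem _ hG))
      (fun G hG => hd G (Set.mem_insert_of_mem _ hG)) _ hO ⟨x, hx, hGx⟩
    refine ⟨x', hx'.1, ?_⟩
    rintro G' (rfl | hG')
    · exact hx'.2
    · exact h' G' hG'

theorem affine_dense {a : V n} (ha : a ≠ 0) (b : ℝ) (U : Set (V n)) (hU : IsOpen U)
    (hne : U.Nonempty) : ∃ x ∈ U, ⟪x, a⟫ - b ≠ 0 := by
  obtain ⟨x, hx⟩ := hne
  by_cases h0 : ⟪x, a⟫ - b = 0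
  · have hcont : Continuous (fun t : ℝ => x + t • a) := by fun_prop
    have hO : IsOpen ((fun t : ℝ => x + t • a) ⁻¹' U) := hU.preimage hcont
    obtain ⟨ε, hε, hb⟩ := Metric.isOpen_iff.1 hO 0 (by simpa using hx)
    refine ⟨x + (ε / 2) • a, hb ?_, ?_⟩
    · simp [abs_of_pos hε]
      linarith
    · rw [inner_add_left, real_inner_smul_left]
      have h1 : 0 < ⟪a, a⟫ := by
        rw [real_inner_self_eq_norm_sq]
        have := norm_pos_iff.2 ha
        positivity
      have h2 : 0 < ε / 2 * ⟪a, a⟫ := by positivity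
      intro h3
      linarith
  · exact ⟨x, hx, h0⟩

theorem region_open {x : V n} (hx : Gen Ψ x) :
    ∃ U : Set (V n), IsOpen U ∧ U.Nonempty ∧ ∀ x' ∈ U, ∀ g ∈ hyp Ψ, 0 < g x * g x' := by
  refine ⟨⋂ β ∈ Ψ, {x' | (⌊⟪x, β⟫⌋ : ℝ) < ⟪x', β⟫} ∩ {x' | ⟪x', β⟫ < ⌊⟪x, β⟫⌋ + 1}, ?_, ?_, ?_⟩
  · apply isOpen_biInter_finset
    intro β _
    exact (isOpen_lt continuous_const (by fun_prop)).inter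
      (isOpen_lt (by fun_prop) continuous_const)
  · refine ⟨x, ?_⟩
    simp only [Set.mem_iInter]
    intro β hβ
    change ((⌊⟪x, β⟫⌋ : ℝ) < ⟪x, β⟫) ∧ (⟪x, β⟫ < ⌊⟪x, β⟫⌋ + 1)
    refine ⟨lt_of_le_of_ne (Int.floor_le _) ?_, Int.lt_floor_add_one _⟩
    intro e
    exact hx _ ⟨β, hβ, ⌊⟪x, β⟫⌋, rfl⟩ (sub_eq_zero.2 e.symm)
  · rintro x' hx' g ⟨β, hβ, k, rfl⟩
    simp only [Set.mem_iInter] at hx'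
    obtain ⟨h1, h2⟩ := hx' β hβ
    change (⌊⟪x, β⟫⌋ : ℝ) < ⟪x', β⟫ at h1
    change ⟪x', β⟫ < ⌊⟪x, β⟫⌋ + 1 at h2
    have h3 := hx _ ⟨β, hβ, k, rfl⟩
    simp only [] at h3 ⊢
    rcases le_or_gt k ⌊⟪x, β⟫⌋ with h | h
    · have h' : (k : ℝ) ≤ ⌊⟪x, β⟫⌋ := by exact_mod_cast h
      have h4 := Int.floor_le ⟪x, β⟫
      have h5 : 0 < ⟪x, β⟫ - (k : ℝ) := lt_of_le_of_ne (by linarith) h3.symm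
      exact mul_pos h5 (by linarith)
    · have h' : (⌊⟪x, β⟫⌋ : ℝ) + 1 ≤ k := by exact_mod_cast h
      have h4 := Int.lt_floor_add_one ⟪x, β⟫
      exact mul_pos_of_neg_of_neg (by linarith) (by linarith)

theorem hyp_affine {h : V n → ℝ} (hh : h ∈ hyp Ψ) (x y : V n) (t : ℝ) :
    h (x + t • (y - x)) = (1 - t) * h x + t * h y := by
  obtain ⟨β, _, k, rfl⟩ := hh
  simp only [inner_add_left, real_inner_smul_left, inner_sub_left]
  ring

theorem exists_facet (D : GeoData Ψ v) {x y : V n} (hx : Gen Ψ x) (hy : Gen Ψ y)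
    (hle : PLe Ψ v x y) (hlt : ¬ PLe Ψ v y x) :
    ∃ h ∈ hyp Ψ, 0 < slp v h ∧ h x < 0 ∧ 0 < h y ∧ Facet Ψ x h := by
  set S := {h | h ∈ hyp Ψ ∧ 0 < slp v h ∧ h x < 0 ∧ 0 < h y} with hS
  have hfin : S.Finite := sep_finite Ψ v x y
  have hSne : S.Nonempty := by
    unfold PLe at hlt
    push Not at hlt
    obtain ⟨h, h1, h2, h3, h4⟩ := hlt
    exact ⟨h, h1, h2, lt_of_le_of_ne h4 (hx h h1), h3⟩
  obtain ⟨U, hU, hUne, hUx⟩ := region_open hx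
  set T : Set (V n → ℝ) := (fun q : (V n → ℝ) × (V n → ℝ) =>
    (fun z => q.1 z * q.2 y - q.2 z * q.1 y : V n → ℝ)) '' S.offDiag with hT
  have hTfin : T.Finite := by
    apply Set.Finite.image
    exact hfin.offDiag
  have hform : ∀ G ∈ T, ∃ a b, a ≠ 0 ∧ G = fun z => ⟪z, a⟫ - b := by
    rintro G ⟨⟨h, h'⟩, ⟨hh, hh', hne⟩, rfl⟩
    obtain ⟨⟨β, hβ, k, rfl⟩, s1, x1, y1⟩ := hh
    obtain ⟨⟨β', hβ', k', rfl⟩, s2, x2, y2⟩ := hh'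
    simp only [] at y1 y2 x1 x2 hne ⊢
    refine ⟨(⟪y, β'⟫ - (k' : ℝ)) • β - (⟪y, β⟫ - (k : ℝ)) • β',
      k * (⟪y, β'⟫ - (k' : ℝ)) - k' * (⟪y, β⟫ - (k : ℝ)), ?_, ?_⟩
    · intro e
      rw [sub_eq_zero] at e
      have e2 : β' = ((⟪y, β⟫ - (k : ℝ))⁻¹ * (⟪y, β'⟫ - (k' : ℝ))) • β := by
        rw [mul_smul, e, smul_smul, inv_mul_cancel₀ y1.ne', one_smul]
      rw [slp_mk] at s1 s2
      rcases D.reduced β hβ β' hβ' _ e2 with e3 | e3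
      · subst e3
        have hb : β' ≠ 0 := fun e => by simp [e] at s2
        have e4 := smul_left_injective ℝ hb e
        have e5 : (k : ℝ) = k' := by linarith
        apply hne
        rw [e5]
      · rw [e3, inner_neg_right] at s2
        linarith
    · funext z
      rw [inner_sub_right, real_inner_smul_right, real_inner_smul_right]
      ring
  obtain ⟨x', hx'U, hx'T⟩ := perturb hTfin
    (fun G hG => by obtain ⟨a, b, _, rfl⟩ := hform G hG; fun_prop)
    (fun G hG U hU hUne => by
      obtain ⟨a, b, ha, rfl⟩ := hform G hG; exact affine_dense ha b U hU hUne) U hU hUne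
  have hsame := hUx x' hx'U
  have hneg' : ∀ g ∈ hyp Ψ, g x < 0 → g x' < 0 := fun g hg h => by
    have := hsame g hg; nlinarith
  have hpos' : ∀ g ∈ hyp Ψ, 0 < g x → 0 < g x' := fun g hg h => by
    have := hsame g hg; by_contra h'; nlinarith
  obtain ⟨h, hhS, hmin⟩ := Set.exists_min_image S (fun h => -h x' / (h y - h x')) hfin hSne
  obtain ⟨hh, hsl, hhx, hhy⟩ := hhS
  have hhx' := hneg' h hh hhx
  set t := -h x' / (h y - h x') with ht
  have hden : 0 < h y - h x' := by linarith
  have ht0 : 0 < t := div_pos (by linarith) hden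
  have ht1 : t < 1 := by rw [ht, div_lt_one hden]; linarith
  refine ⟨h, hh, hsl, hhx, hhy, x' + t • (y - x'), ?_, ?_⟩
  · rw [hyp_affine hh]
    have : t * (h y - h x') = -h x' := by rw [ht]; field_simp
    linarith
  · have main : ∀ g ∈ hyp Ψ, 0 < slp v g → g ≠ h → 0 < g (x' + t • (y - x')) * g x := by
      intro g hg gs gne
      rw [hyp_affine hg]
      rcases lt_or_gt_of_ne (hx g hg) with gx | gx
      · have gx' := hneg' g hg gx
        apply mul_pos_of_neg_of_neg _ gx
        rcases lt_or_gt_of_ne (hy g hg) with gy | gy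
        · nlinarith [mul_pos (sub_pos.2 ht1) (neg_pos.2 gx'), mul_pos ht0 (neg_pos.2 gy)]
        · have hgS : g ∈ S := ⟨hg, gs, gx, gy⟩
          have h1 := hmin g hgS
          have hdg : 0 < g y - g x' := by linarith
          have h2 : t ≠ -g x' / (g y - g x') := by
            intro e
            rw [ht, div_eq_div_iff hden.ne' hdg.ne'] at e
            refine hx'T _ ⟨(g, h), ⟨hgS, ⟨hh, hsl, hhx, hhy⟩, gne⟩, rfl⟩ ?_
            simp only []
            linarith
          have h3 : t < -g x' / (g y - g x') := lt_of_le_of_ne h1 h2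
          rw [lt_div_iff₀ hdg] at h3
          linarith
      · have gx' := hpos' g hg gx
        have gy := hle g hg gs gx
        apply mul_pos _ gx
        nlinarith [mul_pos (sub_pos.2 ht1) gx', mul_pos ht0 gy]
    intro g hg g1 g2
    rcases lt_or_gt_of_ne (slp_ne D hg) with gs | gs
    · have := main (-g) (hyp_neg D hg) (by rw [slp_neg]; linarith)
        (fun e => g2 (by rw [← e, neg_neg]))
      simpa using this
    · exact main g hg gs g1


/-- Nonnegative combinations of two given functions. -/
def RR (Ψ : Finset (V n)) (v : V n) (h₁ h₂ : V n → ℝ) : Set (V n → ℝ) :=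
  {h | h ∈ hyp Ψ ∧ 0 < slp v h ∧ ∃ c₁ c₂ : ℝ, 0 ≤ c₁ ∧ 0 ≤ c₂ ∧ h = c₁ • h₁ + c₂ • h₂}

theorem RR_pos {h₁ h₂ : V n → ℝ} {z : V n} (hz : Gen Ψ z) (z₁ : 0 < h₁ z) (z₂ : 0 < h₂ z)
    {h : V n → ℝ} (hh : h ∈ RR Ψ v h₁ h₂) : 0 < h z := by
  obtain ⟨a, _, c₁, c₂, p₁, p₂, e⟩ := hh
  refine lt_of_le_of_ne ?_ (hz h a).symm
  rw [e]
  simp only [Pi.add_apply, Pi.smul_apply, smul_eq_mul]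
  positivity

theorem RR_neg {h₁ h₂ : V n → ℝ} {z : V n} (hz : Gen Ψ z) (z₁ : h₁ z < 0) (z₂ : h₂ z < 0)
    {h : V n → ℝ} (hh : h ∈ RR Ψ v h₁ h₂) : h z < 0 := by
  obtain ⟨a, _, c₁, c₂, p₁, p₂, e⟩ := hh
  refine lt_of_le_of_ne ?_ (hz h a)
  rw [e]
  simp only [Pi.add_apply, Pi.smul_apply, smul_eq_mul]
  nlinarith

/-- State of the rank-two walk. -/
structure St (Ψ : Finset (V n)) (v : V n) (h₁ h₂ : V n → ℝ) (m r : V n) (g₁ g₂ : V n → ℝ) :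
    Prop where
  gen : Gen Ψ r
  m₁ : g₁ ∈ hyp Ψ
  m₂ : g₂ ∈ hyp Ψ
  ne : g₁ ≠ g₂
  F₁ : Facet Ψ r g₁
  F₂ : Facet Ψ r g₂
  n₁ : g₁ r < 0
  n₂ : g₂ r < 0
  c₁ : ∃ a b : ℝ, g₁ = a • h₁ + b • h₂
  c₂ : ∃ a b : ℝ, g₂ = a • h₁ + b • h₂
  d₁ : ∃ a b : ℝ, h₁ = a • g₁ + b • g₂
  d₂ : ∃ a b : ℝ, h₂ = a • g₁ + b • g₂
  off : ∀ h ∈ hyp Ψ, 0 < slp v h → h ∉ RR Ψ v h₁ h₂ → 0 < h m * h r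

theorem St.symm {h₁ h₂ : V n → ℝ} {m r : V n} {g₁ g₂ : V n → ℝ} (S : St Ψ v h₁ h₂ m r g₁ g₂) :
    St Ψ v h₁ h₂ m r g₂ g₁ where
  gen := S.gen
  m₁ := S.m₂
  m₂ := S.m₁
  ne := S.ne.symm
  F₁ := S.F₂
  F₂ := S.F₁
  n₁ := S.n₂
  n₂ := S.n₁
  c₁ := S.c₂
  c₂ := S.c₁
  d₁ := by obtain ⟨a, b, e⟩ := S.d₁; exact ⟨b, a, by rw [e, add_comm]⟩
  d₂ := by obtain ⟨a, b, e⟩ := S.d₂; exact ⟨b, a, by rw [e, add_comm]⟩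
  off := S.off

theorem mul_pos_trans {a b c : ℝ} (h1 : 0 < a * b) (h2 : 0 < b * c) : 0 < a * c := by
  have := mul_pos h1 h2
  have e : a * b * (b * c) = b ^ 2 * (a * c) := by ring
  rw [e] at this
  by_contra h
  nlinarith [sq_nonneg b]

theorem state_step (D : GeoData Ψ v) {m : V n} {h₁ h₂ : V n → ℝ} (S₀ : St Ψ v h₁ h₂ m m h₁ h₂)
    (s₁ : 0 < slp v h₁) (s₂ : 0 < slp v h₂) (hfin : (RR Ψ v h₁ h₂).Finite)
    {r : V n} {g₁ g₂ : V n → ℝ} (S : St Ψ v h₁ h₂ m r g₁ g₂) (hs : 0 < slp v g₁) :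
    ∃ r' g₁' g₂', St Ψ v h₁ h₂ m r' g₁' g₂' ∧
      {h | h ∈ RR Ψ v h₁ h₂ ∧ h r' < 0}.ncard < {h | h ∈ RR Ψ v h₁ h₂ ∧ h r < 0}.ncard := by
  have hg₁R : g₁ ∈ RR Ψ v h₁ h₂ := by
    obtain ⟨a, b, e⟩ := S.c₁
    refine ⟨S.m₁, hs, a, b, ?_⟩
    have hsl := slp_comb v e
    rcases same_sign S₀.m₁ S₀.m₂ S₀.F₁ S₀.F₂ S₀.n₁ S₀.n₂ S₀.ne S.m₁ e with h | h
    · exact ⟨h.1, h.2, e⟩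
    · nlinarith [h.1, h.2]
  obtain ⟨s, hss, hfix, hneg, hcl⟩ := exists_refl D S.m₁
  have hcl' : ∀ g ∈ hyp Ψ, g ∘ s ∈ hyp Ψ := fun g hg => (hcl g hg).1
  obtain ⟨c, hc⟩ := (hcl g₂ S.m₂).2
  have flip := facet_flip S.F₁ hss hfix hneg hcl'
  have hnn : ∀ h : V n → ℝ, 0 < slp v h → h ≠ -g₁ := by
    intro h hh e
    rw [e, slp_neg] at hh
    linarith
  refine ⟨s r, g₁ ∘ s, g₂ ∘ s, ?_, ?_⟩
  · refine ⟨fun h hh => S.gen (h ∘ s) (hcl' h hh), hcl' _ S.m₁, hcl' _ S.m₂, ?_,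
      facet_transport S.F₁ hss hcl', facet_transport S.F₂ hss hcl', ?_, ?_, ?_, ?_, ?_, ?_, ?_⟩
    · intro e
      apply S.ne
      rw [comp_cancel hss e, comp_inv_eq hss]
    · simpa [hss] using S.n₁
    · simpa [hss] using S.n₂
    · obtain ⟨a, b, e⟩ := S.c₁
      refine ⟨-a, -b, ?_⟩
      rw [hneg, e]; module
    · obtain ⟨a, b, e⟩ := S.c₁
      obtain ⟨a', b', e'⟩ := S.c₂
      refine ⟨a' - c * a, b' - c * b, ?_⟩
      rw [hc, e, e']; module
    · obtain ⟨a, b, e⟩ := S.d₁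
      refine ⟨-a - b * c, b, ?_⟩
      rw [hc, hneg, e]; module
    · obtain ⟨a, b, e⟩ := S.d₂
      refine ⟨-a - b * c, b, ?_⟩
      rw [hc, hneg, e]; module
    · intro h hh hsl hR
      exact mul_pos_trans (S.off h hh hsl hR)
        (flip h hh (fun e => hR (e ▸ hg₁R)) (hnn h hsl))
  · have hgs : g₁ (s r) = - g₁ r := congrFun hneg r
    apply Set.ncard_lt_ncard _ (hfin.subset (fun h hh => hh.1))
    refine ⟨fun h hh => ⟨hh.1, ?_⟩, fun hsub => ?_⟩
    · by_cases e : h = g₁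
      · rw [e]; exact S.n₁
      · have := flip h hh.1.1 e (hnn h hh.1.2.1)
        have h2 := hh.2
        by_contra h3
        nlinarith
    · have h2 := (hsub ⟨hg₁R, S.n₁⟩).2
      have := S.n₁
      linarith

theorem state_main (D : GeoData Ψ v) {m : V n} {h₁ h₂ : V n → ℝ} (S₀ : St Ψ v h₁ h₂ m m h₁ h₂)
    (s₁ : 0 < slp v h₁) (s₂ : 0 < slp v h₂) (hfin : (RR Ψ v h₁ h₂).Finite) :
    ∃ j, Gen Ψ j ∧ (∀ h ∈ hyp Ψ, 0 < slp v h → h ∉ RR Ψ v h₁ h₂ → 0 < h m * h j) ∧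
      ∀ h ∈ RR Ψ v h₁ h₂, 0 < h j := by
  suffices H : ∀ N r g₁ g₂, St Ψ v h₁ h₂ m r g₁ g₂ →
      {h | h ∈ RR Ψ v h₁ h₂ ∧ h r < 0}.ncard = N →
      ∃ j, Gen Ψ j ∧ (∀ h ∈ hyp Ψ, 0 < slp v h → h ∉ RR Ψ v h₁ h₂ → 0 < h m * h j) ∧
      ∀ h ∈ RR Ψ v h₁ h₂, 0 < h j from H _ m h₁ h₂ S₀ rfl
  intro N
  induction N using Nat.strong_induction_on with
  | _ N ih =>
  intro r g₁ g₂ S hN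
  by_cases p₁ : 0 < slp v g₁
  · obtain ⟨r', g₁', g₂', S', hlt⟩ := state_step D S₀ s₁ s₂ hfin S p₁
    exact ih _ (hN ▸ hlt) r' g₁' g₂' S' rfl
  by_cases p₂ : 0 < slp v g₂
  · obtain ⟨r', g₁', g₂', S', hlt⟩ := state_step D S₀ s₁ s₂ hfin S.symm p₂
    exact ih _ (hN ▸ hlt) r' g₁' g₂' S' rfl
  refine ⟨r, S.gen, S.off, ?_⟩
  rintro h ⟨hh, hsl, c₁, c₂, -, -, e⟩
  obtain ⟨a, b, e₁⟩ := S.d₁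
  obtain ⟨a', b', e₂⟩ := S.d₂
  have e3 : h = (c₁ * a + c₂ * a') • g₁ + (c₁ * b + c₂ * b') • g₂ := by
    rw [e, e₁, e₂]; module
  have hsl' := slp_comb v e3
  have hr : h r = (c₁ * a + c₂ * a') * g₁ r + (c₁ * b + c₂ * b') * g₂ r := by
    conv_lhs => rw [e3]
    simp
  have n₁ := S.n₁
  have n₂ := S.n₂
  rcases same_sign S.m₁ S.m₂ S.F₁ S.F₂ S.n₁ S.n₂ S.ne hh e3 with h | h
  · nlinarith [h.1, h.2]
  · exact lt_of_le_of_ne (by nlinarith [h.1, h.2]) (S.gen _ hh).symm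

/-- Generic points of the box. -/
def InBox (Ψ : Finset (V n)) (v x : V n) : Prop :=
  Gen Ψ x ∧ ∀ β ∈ Ψ, 0 < ⟪v, β⟫ → 0 < ⟪x, β⟫ ∧ ⟪x, β⟫ < ⟪v, β⟫

/-- The type of generic points of the box. -/
def Pt (Ψ : Finset (V n)) (v : V n) : Type := {x : V n // InBox Ψ v x}

instance : Preorder (Pt Ψ v) where
  le x y := PLe Ψ v x.1 y.1
  le_refl _ _ _ _ h := h
  le_trans _ _ _ h1 h2 h a b c := h2 h a b (h1 h a b c)

theorem box_convex (D : GeoData Ψ v) {x y : Pt Ψ v} {z : V n} (hz : Gen Ψ z)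
    (h1 : PLe Ψ v x.1 z) (h2 : PLe Ψ v z y.1) : InBox Ψ v z := by
  refine ⟨hz, fun β hβ hv => ⟨?_, ?_⟩⟩
  · have := h1 (fun x => ⟪x, β⟫ - ((0 : ℤ) : ℝ)) ⟨β, hβ, 0, rfl⟩ (by rw [slp_mk]; exact hv)
      (by simpa using (x.2.2 β hβ hv).1)
    simpa using this
  · obtain ⟨k, hk⟩ := D.vint β hβ
    by_contra hcon
    have hmem : (fun x => ⟪x, β⟫ - (k : ℝ)) ∈ hyp Ψ := ⟨β, hβ, k, rfl⟩
    have hpos : 0 < ⟪z, β⟫ - (k : ℝ) :=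
      lt_of_le_of_ne (by rw [← hk]; linarith) (hz _ hmem).symm
    have := h2 _ hmem (by rw [slp_mk]; exact hv) hpos
    have h3 := (y.2.2 β hβ hv).2
    linarith

theorem dual_hyp (D : GeoData Ψ v) {h : V n → ℝ} (hh : h ∈ hyp Ψ) :
    ∃ g ∈ hyp Ψ, slp v g = slp v h ∧ ∀ x, h (v - x) = - g x := by
  obtain ⟨β, hβ, k, rfl⟩ := hh
  obtain ⟨K, hK⟩ := D.vint β hβ
  refine ⟨_, ⟨β, hβ, K - k, rfl⟩, by rw [slp_mk, slp_mk], fun x => ?_⟩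
  simp only [inner_sub_left, hK]
  push_cast
  ring

theorem dual_gen (D : GeoData Ψ v) {x : V n} (hx : Gen Ψ x) : Gen Ψ (v - x) := by
  intro h hh
  obtain ⟨g, hg, _, e⟩ := dual_hyp D hh
  rw [e, neg_ne_zero]
  exact hx g hg

theorem dual_le (D : GeoData Ψ v) {x y : V n} (hx : Gen Ψ x) (h : PLe Ψ v x y) :
    PLe Ψ v (v - y) (v - x) := by
  intro f hf fs fy
  obtain ⟨g, hg, es, e⟩ := dual_hyp D hf
  rw [e] at fy ⊢
  rcases lt_or_gt_of_ne (hx g hg) with h' | h'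
  · linarith
  · have := h g hg (by rw [es]; exact fs) h'
    linarith

/-- Duality on the box. -/
def dualPt (D : GeoData Ψ v) (x : Pt Ψ v) : Pt Ψ v :=
  ⟨v - x.1, dual_gen D x.2.1, fun β hβ hv => by
    have := x.2.2 β hβ hv
    rw [inner_sub_left]
    constructor <;> linarith⟩

theorem dualPt_dualPt (D : GeoData Ψ v) (x : Pt Ψ v) : dualPt D (dualPt D x) = x :=
  Subtype.ext (by simp [dualPt])

theorem dualPt_le (D : GeoData Ψ v) {x y : Pt Ψ v} : dualPt D y ≤ dualPt D x ↔ x ≤ y := by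
  have H : ∀ x y : Pt Ψ v, x ≤ y → dualPt D y ≤ dualPt D x := fun x y h => dual_le D x.2.1 h
  refine ⟨fun h => ?_, H x y⟩
  have := H _ _ h
  rwa [dualPt_dualPt, dualPt_dualPt] at this

/-- Duality as an order isomorphism. -/
def dualIso (D : GeoData Ψ v) : (Pt Ψ v)ᵒᵈ ≃o Pt Ψ v where
  toFun x := dualPt D (OrderDual.ofDual x)
  invFun x := OrderDual.toDual (dualPt D x)
  left_inv x := dualPt_dualPt D _
  right_inv x := dualPt_dualPt D _
  map_rel_iff' {x y} := dualPt_le D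

theorem exists_eps (Ψ : Finset (V n)) (v : V n) :
    ∃ ε : ℝ, 0 < ε ∧ ε < 1 ∧ ∀ β ∈ Ψ, ε * |⟪v, β⟫| < 1 := by
  set M : ℝ := ∑ β ∈ Ψ, |⟪v, β⟫| with hM
  have hM0 : 0 ≤ M := Finset.sum_nonneg (fun _ _ => abs_nonneg _)
  refine ⟨1 / (M + 2), by positivity, by rw [div_lt_one (by linarith)]; linarith, ?_⟩
  intro β hβ
  have h1 : |⟪v, β⟫| ≤ M := Finset.single_le_sum (f := fun β => |⟪v, β⟫|)
    (fun _ _ => abs_nonneg _) hβ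
  rw [one_div, inv_mul_lt_iff₀ (by linarith)]
  linarith

theorem exists_bot (D : GeoData Ψ v) : ∃ x : Pt Ψ v, ∀ y, x ≤ y := by
  obtain ⟨ε, h0, h1, h2⟩ := exists_eps Ψ v
  refine ⟨⟨ε • v, ?_, ?_⟩, ?_⟩
  · rintro h ⟨β, hβ, k, rfl⟩ e
    simp only [real_inner_smul_left] at e
    have h3 := h2 β hβ
    rw [← abs_of_pos h0, ← abs_mul, sub_eq_zero.1 e] at h3
    have h4 : |k| < 1 := by exact_mod_cast h3
    rw [Int.abs_lt_one_iff] at h4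
    rw [h4] at e
    simp at e
    rcases e with e | e
    · exact h0.ne' e
    · exact D.vne β hβ e
  · intro β hβ hv
    rw [real_inner_smul_left]
    constructor
    · positivity
    · nlinarith
  · rintro y h ⟨β, hβ, k, rfl⟩ hs hpos
    rw [slp_mk] at hs
    simp only [real_inner_smul_left] at hpos ⊢
    have h3 := h2 β hβ
    rw [abs_of_pos hs] at h3
    have h4 : (k : ℝ) < 1 := by linarith
    have h5 : k ≤ 0 := by
      have : k < 1 := by exact_mod_cast h4
      omega
    have h6 : (k : ℝ) ≤ 0 := by exact_mod_cast h5
    have := (y.2.2 β hβ hs).1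
    linarith

/-- Bounded order on the box. -/
@[reducible] def ptBounded (D : GeoData Ψ v) : BoundedOrder (Pt Ψ v) where
  bot := (exists_bot D).choose
  bot_le := (exists_bot D).choose_spec
  top := dualPt D (exists_bot D).choose
  le_top y := by
    rw [← dualPt_dualPt D y, dualPt_le]
    exact (exists_bot D).choose_spec _

theorem pt_lt_sep {x y : Pt Ψ v} (h : x < y) :
    ∃ g ∈ hyp Ψ, 0 < slp v g ∧ g x.1 < 0 ∧ 0 < g y.1 := by
  have h2 : ¬ PLe Ψ v y.1 x.1 := (lt_iff_le_not_ge.1 h).2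
  unfold PLe at h2
  push Not at h2
  obtain ⟨g, hg, gs, gy, gx⟩ := h2
  exact ⟨g, hg, gs, lt_of_le_of_ne gx (x.2.1 g hg), gy⟩

theorem pt_wf_lt (D : GeoData Ψ v) : WellFoundedLT (Pt Ψ v) := by
  obtain ⟨b, hb⟩ := exists_bot D
  let f : Pt Ψ v → ℕ := fun x => {h | h ∈ hyp Ψ ∧ 0 < slp v h ∧ h b.1 < 0 ∧ 0 < h x.1}.ncard
  refine ⟨Subrelation.wf (r := InvImage (· < ·) f) ?_ (InvImage.wf f Nat.lt_wfRel.wf)⟩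
  intro x y hxy
  obtain ⟨g, hg, gs, gx, gy⟩ := pt_lt_sep hxy
  apply Set.ncard_lt_ncard _ (sep_finite Ψ v b.1 y.1)
  refine ⟨fun h hh => ⟨hh.1, hh.2.1, hh.2.2.1, hxy.le h hh.1 hh.2.1 hh.2.2.2⟩, fun hsub => ?_⟩
  have gb : g b.1 < 0 := by
    rcases lt_or_gt_of_ne (b.2.1 g hg) with h | h
    · exact h
    · have := hb x g hg gs h
      linarith
  have := (hsub ⟨hg, gs, gb, gy⟩).2.2.2
  linarith

theorem pt_wf_gt (D : GeoData Ψ v) : WellFoundedGT (Pt Ψ v) := by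
  have := pt_wf_lt D
  refine ⟨Subrelation.wf (r := InvImage (· < ·) (dualPt D)) ?_ (InvImage.wf _ this.wf)⟩
  intro x y hxy
  exact lt_iff_le_not_ge.2 ⟨(dualPt_le D).2 hxy.le,
    fun h => (lt_iff_le_not_ge.1 hxy).2 ((dualPt_le D).1 h)⟩

theorem pt_cover (D : GeoData Ψ v) {x y : Pt Ψ v} (hxy : x ⋖ y) :
    ∃ h ∈ hyp Ψ, 0 < slp v h ∧ h x.1 < 0 ∧ Facet Ψ x.1 h ∧
      ∀ g ∈ hyp Ψ, 0 < slp v g → (0 < g y.1 ↔ 0 < g x.1 ∨ g = h) := by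
  obtain ⟨h, hh, hs, hx, hy, hF⟩ := exists_facet D x.2.1 y.2.1 hxy.1.le
    (lt_iff_le_not_ge.1 hxy.1).2
  refine ⟨h, hh, hs, hx, hF, ?_⟩
  obtain ⟨s, hss, hfix, hneg, hcl⟩ := exists_refl D hh
  have hcl' : ∀ g ∈ hyp Ψ, g ∘ s ∈ hyp Ψ := fun g hg => (hcl g hg).1
  have flip := facet_flip hF hss hfix hneg hcl'
  have hsx : h (s x.1) = - h x.1 := congrFun hneg x.1
  have hc : ∀ g ∈ hyp Ψ, 0 < slp v g → (0 < g (s x.1) ↔ 0 < g x.1 ∨ g = h) := by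
    intro g hg gs
    by_cases e : g = h
    · subst e
      simp only [or_true, iff_true]
      linarith
    · have := flip g hg e (fun e => by rw [e, slp_neg] at gs; linarith)
      simp only [e, or_false]
      constructor <;> intro h' <;> by_contra h'' <;> nlinarith
  have gen : Gen Ψ (s x.1) := fun g hg => x.2.1 (g ∘ s) (hcl' g hg)
  have le1 : PLe Ψ v x.1 (s x.1) := fun g hg gs hpos => (hc g hg gs).2 (Or.inl hpos)
  have le2 : PLe Ψ v (s x.1) y.1 := fun g hg gs hpos => by
    rcases (hc g hg gs).1 hpos with h' | h'
    · exact hxy.1.le g hg gs h'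
    · rw [h']; exact hy
  let c : Pt Ψ v := ⟨s x.1, box_convex D gen le1 le2⟩
  have hxc : x < c := lt_iff_le_not_ge.2 ⟨le1, fun hcx => by
    have := hcx h hh hs (by change 0 < h (s x.1); linarith)
    linarith⟩
  have hyc : y ≤ c := by
    by_contra hn
    exact hxy.2 hxc (lt_iff_le_not_ge.2 ⟨le2, hn⟩)
  intro g hg gs
  rw [← hc g hg gs]
  exact ⟨fun h' => hyc g hg gs h', fun h' => le2 g hg gs h'⟩

theorem pt_half (D : GeoData Ψ v) : HalfCond (Pt Ψ v) := by
  intro m a₁ a₂ hc₁ hc₂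
  obtain ⟨h₁, m₁, s₁, n₁, F₁, e₁⟩ := pt_cover D hc₁
  obtain ⟨h₂, m₂, s₂, n₂, F₂, e₂⟩ := pt_cover D hc₂
  have p₁ : 0 < h₁ a₁.1 := (e₁ h₁ m₁ s₁).2 (Or.inr rfl)
  have p₂ : 0 < h₂ a₂.1 := (e₂ h₂ m₂ s₂).2 (Or.inr rfl)
  by_cases hne : h₁ = h₂
  · subst hne
    have h21 : a₂ ≤ a₁ := fun g hg gs h => (e₁ g hg gs).2 ((e₂ g hg gs).1 h)
    refine ⟨a₁, ?_, fun m' a _ _ ha => Or.inl ha⟩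
    rw [isLUB_pair_iff]
    exact ⟨le_rfl, h21, fun z hz _ => hz⟩
  obtain ⟨t, ht⟩ : ∃ t : Pt Ψ v, ∀ y, y ≤ t := ⟨(ptBounded D).top, (ptBounded D).le_top⟩
  have hfin : (RR Ψ v h₁ h₂).Finite := (sep_finite Ψ v m.1 t.1).subset fun h hh =>
    ⟨hh.1, hh.2.1, RR_neg m.2.1 n₁ n₂ hh,
      RR_pos t.2.1 (ht a₁ h₁ m₁ s₁ p₁) (ht a₂ h₂ m₂ s₂ p₂) hh⟩
  have S₀ : St Ψ v h₁ h₂ m.1 m.1 h₁ h₂ :=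
    ⟨m.2.1, m₁, m₂, hne, F₁, F₂, n₁, n₂, ⟨1, 0, by simp⟩, ⟨0, 1, by simp⟩, ⟨1, 0, by simp⟩,
      ⟨0, 1, by simp⟩, fun h hh _ _ => mul_self_pos.2 (m.2.1 h hh)⟩
  obtain ⟨j, jg, joff, jR⟩ := state_main D S₀ s₁ s₂ hfin
  have r₁ : h₁ ∈ RR Ψ v h₁ h₂ := ⟨m₁, s₁, 1, 0, by simp, le_rfl, by simp⟩
  have r₂ : h₂ ∈ RR Ψ v h₁ h₂ := ⟨m₂, s₂, 0, 1, le_rfl, by simp, by simp⟩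
  have offpos : ∀ h ∈ hyp Ψ, 0 < slp v h → h ∉ RR Ψ v h₁ h₂ → (0 < h m.1 ↔ 0 < h j) := by
    intro h hh hs hR
    have := joff h hh hs hR
    constructor <;> intro h' <;> by_contra h'' <;> nlinarith
  have mj : PLe Ψ v m.1 j := by
    intro h hh hs hpos
    by_cases hR : h ∈ RR Ψ v h₁ h₂
    · exact jR h hR
    · exact (offpos h hh hs hR).1 hpos
  have jz : ∀ z : Pt Ψ v, a₁ ≤ z → a₂ ≤ z → PLe Ψ v j z.1 := by
    intro z z₁ z₂ h hh hs hpos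
    by_cases hR : h ∈ RR Ψ v h₁ h₂
    · exact RR_pos z.2.1 (z₁ h₁ m₁ s₁ p₁) (z₂ h₂ m₂ s₂ p₂) hR
    · exact z₁ h hh hs (hc₁.1.le h hh hs ((offpos h hh hs hR).2 hpos))
  let J : Pt Ψ v := ⟨j, box_convex D jg mj (jz t (ht _) (ht _))⟩
  refine ⟨J, ?_, ?_⟩
  · rw [isLUB_pair_iff]
    refine ⟨fun h hh hs hpos => ?_, fun h hh hs hpos => ?_, jz⟩
    · rcases (e₁ h hh hs).1 hpos with h' | rfl
      · exact mj h hh hs h'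
      · exact jR _ r₁
    · rcases (e₂ h hh hs).1 hpos with h' | rfl
      · exact mj h hh hs h'
      · exact jR _ r₂
  · intro m' a hm' hca haj
    obtain ⟨L, hL, sL, nL, FL, eL⟩ := pt_cover D hca
    have pL : 0 < L a.1 := (eL L hL sL).2 (Or.inr rfl)
    have pj : 0 < L j := haj L hL sL pL
    by_cases hLm : 0 < L m.1
    · left
      intro g hg gs hpos
      rcases (eL g hg gs).1 hpos with h' | rfl
      · exact hc₁.1.le g hg gs (hm' g hg gs h')
      · exact hc₁.1.le _ hg gs hLm
    have hLR : L ∈ RR Ψ v h₁ h₂ := by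
      by_contra hR
      exact hLm ((offpos L hL sL hR).2 pj)
    by_cases hL1 : L = h₁
    · left
      intro g hg gs hpos
      rcases (eL g hg gs).1 hpos with h' | h'
      · exact hc₁.1.le g hg gs (hm' g hg gs h')
      · rw [h', hL1]; exact p₁
    by_cases hL2 : L = h₂
    · right
      intro g hg gs hpos
      rcases (eL g hg gs).1 hpos with h' | h'
      · exact hc₂.1.le g hg gs (hm' g hg gs h')
      · rw [h', hL2]; exact p₂
    exfalso
    obtain ⟨p, hp, hp'⟩ := FL
    have key : ∀ h ∈ hyp Ψ, 0 < slp v h → h m.1 < 0 → L ≠ h → h p < 0 := by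
      intro h hh hs hm hne
      have h1 := hp' h hh (Ne.symm hne) (fun e => by rw [e, slp_neg] at hs; linarith)
      have h2 : h m'.1 < 0 := by
        rcases lt_or_gt_of_ne (m'.2.1 h hh) with h' | h'
        · exact h'
        · have := hm' h hh hs h'
          linarith
      nlinarith
    have k₁ := key h₁ m₁ s₁ n₁ hL1
    have k₂ := key h₂ m₂ s₂ n₂ hL2
    obtain ⟨-, -, c₁, c₂, q₁, q₂, e⟩ := hLR
    have hsl := slp_comb v e
    rw [e] at hp
    simp only [Pi.add_apply, Pi.smul_apply, smul_eq_mul] at hp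
    have z1 : c₁ = 0 := by
      by_contra hz
      have : 0 < c₁ := lt_of_le_of_ne q₁ (Ne.symm hz)
      nlinarith
    have z2 : c₂ = 0 := by
      by_contra hz
      have : 0 < c₂ := lt_of_le_of_ne q₂ (Ne.symm hz)
      nlinarith
    rw [z1, z2] at hsl
    simp at hsl
    linarith

end Geometry


/-! ### Part D: root systems -/

section Roots

variable {n : ℕ}

open Classical in
/-- Coroots of indivisible roots. -/
def corootSet (Φ : Finset (V n)) : Finset (V n) :=
  (Φ.filter (fun α => (1 / 2 : ℝ) • α ∉ Φ)).image covec

theorem mem_corootSet {Φ : Finset (V n)} {β : V n} :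
    β ∈ corootSet Φ ↔ ∃ α ∈ Φ, (1 / 2 : ℝ) • α ∉ Φ ∧ β = covec α := by
  classical
  simp only [corootSet, Finset.mem_image, Finset.mem_filter]
  constructor
  · rintro ⟨α, ⟨h1, h2⟩, h3⟩
    exact ⟨α, h1, h2, h3.symm⟩
  · rintro ⟨α, h1, h2, h3⟩
    exact ⟨α, ⟨h1, h2⟩, h3.symm⟩

theorem inner_self_pos {α : V n} (h : α ≠ 0) : 0 < ⟪α, α⟫ := by
  rw [real_inner_self_eq_norm_sq]
  have := norm_pos_iff.2 h
  positivity

theorem inner_covec_self {α : V n} (h : α ≠ 0) : ⟪α, covec α⟫ = 2 := by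
  have := inner_self_pos h
  rw [covec, real_inner_smul_right]
  field_simp

theorem covec_smul (α : V n) (c : ℝ) : covec (c • α) = c⁻¹ • covec α := by
  by_cases hc : c = 0
  · subst hc; simp [covec]
  rw [covec, covec, real_inner_smul_left, real_inner_smul_right, smul_smul, smul_smul]
  congr 1
  field_simp

theorem covec_neg (α : V n) : covec (-α) = -covec α := by
  simp [covec]

theorem covec_covec {α : V n} (h : α ≠ 0) : covec (covec α) = α := by
  have h2 : covec α = (2 / ⟪α, α⟫) • α := rfl
  have := inner_self_pos h
  rw [h2, covec_smul, h2, smul_smul, inv_mul_cancel₀ (by positivity), one_smul]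

theorem covec_refl {α δ : V n} (hα : α ≠ 0) :
    covec (δ - ⟪δ, covec α⟫ • α) = covec δ - ⟪covec δ, α⟫ • covec α := by
  have h0 := inner_self_pos hα
  have e : ⟪δ - ⟪δ, covec α⟫ • α, δ - ⟪δ, covec α⟫ • α⟫ = ⟪δ, δ⟫ := by
    simp only [covec, inner_sub_left, inner_sub_right, real_inner_smul_left,
      real_inner_smul_right, real_inner_comm δ α]
    field_simp
    ring
  unfold covec at e ⊢
  rw [e, smul_sub, smul_smul, smul_smul, real_inner_smul_left, real_inner_smul_right]
  congr 2
  ring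

theorem dual_vec {Φ Δ : Finset (V n)} (hΔ : IsSimpleSys Φ Δ) (f : V n → ℝ) :
    ∃ v : V n, ∀ d ∈ Δ, ⟪v, d⟫ = f d := by
  obtain ⟨g, hg⟩ := LinearMap.exists_extend
    ((Module.Basis.span hΔ.indep).constr ℝ (fun d : (Δ : Set (V n)) => f d))
  refine ⟨(InnerProductSpace.toDual ℝ (V n)).symm (LinearMap.toContinuousLinearMap g), ?_⟩
  intro d hd
  rw [InnerProductSpace.toDual_symm_apply]
  have h1 := (Module.Basis.span hΔ.indep).constr_basis ℝ (fun d : (Δ : Set (V n)) => f d) ⟨d, hd⟩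
  rw [← hg] at h1
  simp only [LinearMap.comp_apply, Submodule.subtype_apply, Module.Basis.span_apply] at h1
  simpa using h1

theorem simple_pos {Φ Δ : Finset (V n)} (hΦ : IsCrystRS Φ) (hΔ : IsSimpleSys Φ Δ) {v : V n}
    (hv : ∀ d ∈ Δ, ⟪v, covec d⟫ = 1) {d : V n} (hd : d ∈ Δ) : 0 < ⟪v, d⟫ := by
  have h := hv d hd
  have h0 := inner_self_pos (hΦ.ne_zero d (hΔ.subset hd))
  rw [covec, real_inner_smul_right] at h
  by_contra hc
  have : 0 < 2 / ⟪d, d⟫ := by positivity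
  nlinarith

theorem posRoot_pos {Φ Δ : Finset (V n)} (hΦ : IsCrystRS Φ) (hΔ : IsSimpleSys Φ Δ) {v : V n}
    (hv : ∀ d ∈ Δ, ⟪v, covec d⟫ = 1) {α : V n} (hα : α ≠ 0) (hp : IsPosRoot Δ α) :
    0 < ⟪v, α⟫ := by
  obtain ⟨c, hc, e⟩ := hp
  have hex : ∃ d ∈ Δ, 0 < c d := by
    by_contra hn
    push Not at hn
    apply hα
    rw [e]
    apply Finset.sum_eq_zero
    intro d hd
    rw [le_antisymm (hn d hd) (hc d hd), zero_smul]
  obtain ⟨d, hd, hcd⟩ := hex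
  rw [e, inner_sum]
  simp only [real_inner_smul_right]
  exact Finset.sum_pos' (fun d hd => mul_nonneg (hc d hd) (simple_pos hΦ hΔ hv hd).le)
    ⟨d, hd, mul_pos hcd (simple_pos hΦ hΔ hv hd)⟩

theorem root_cases {Φ Δ : Finset (V n)} (hΔ : IsSimpleSys Φ Δ) {α : V n} (h : α ∈ Φ) :
    IsPosRoot Δ α ∨ IsPosRoot Δ (-α) := by
  rcases hΔ.decomp α h with ⟨c, hc, e⟩ | ⟨c, hc, e⟩
  · exact Or.inl ⟨c, hc, e⟩
  · exact Or.inr ⟨c, hc, by rw [e, neg_neg]⟩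

theorem posRoot_iff {Φ Δ : Finset (V n)} (hΦ : IsCrystRS Φ) (hΔ : IsSimpleSys Φ Δ) {v : V n}
    (hv : ∀ d ∈ Δ, ⟪v, covec d⟫ = 1) {α : V n} (hα : α ∈ Φ) :
    IsPosRoot Δ α ↔ 0 < ⟪v, α⟫ := by
  have h0 := hΦ.ne_zero α hα
  refine ⟨posRoot_pos hΦ hΔ hv h0, fun h => ?_⟩
  rcases root_cases hΔ hα with h' | h'
  · exact h'
  · have := posRoot_pos hΦ hΔ hv (neg_ne_zero.2 h0) h'
    rw [inner_neg_right] at this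
    linarith

theorem root_ne {Φ Δ : Finset (V n)} (hΦ : IsCrystRS Φ) (hΔ : IsSimpleSys Φ Δ) {v : V n}
    (hv : ∀ d ∈ Δ, ⟪v, covec d⟫ = 1) {α : V n} (hα : α ∈ Φ) : ⟪v, α⟫ ≠ 0 := by
  have h0 := hΦ.ne_zero α hα
  rcases root_cases hΔ hα with h' | h'
  · exact (posRoot_pos hΦ hΔ hv h0 h').ne'
  · have := posRoot_pos hΦ hΔ hv (neg_ne_zero.2 h0) h'
    rw [inner_neg_right] at this
    intro e
    linarith

theorem covec_pos_iff {v α : V n} (h : α ≠ 0) : 0 < ⟪v, covec α⟫ ↔ 0 < ⟪v, α⟫ := by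
  have := inner_self_pos h
  rw [covec, real_inner_smul_right]
  exact mul_pos_iff_of_pos_left (by positivity)

/-- Every coroot is, up to a factor one or two, the coroot of an indivisible root. -/
theorem exists_indiv {Φ : Finset (V n)} (hΦ : IsCrystRS Φ) {α : V n} (hα : α ∈ Φ) :
    ∃ t : ℤ, 0 < t ∧ (t : ℝ) • covec α ∈ corootSet Φ := by
  by_cases h1 : (1 / 2 : ℝ) • α ∈ Φ
  · refine ⟨2, by norm_num, ?_⟩
    rw [mem_corootSet]
    refine ⟨_, h1, ?_, ?_⟩
    · intro h2
      obtain ⟨m, hm⟩ := hΦ.cryst α hα _ h2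
      rw [real_inner_smul_left, real_inner_smul_left, inner_covec_self (hΦ.ne_zero α hα)] at hm
      have h3 : (2 * m : ℝ) = 1 := by rw [← hm]; norm_num
      have h4 : 2 * m = 1 := by exact_mod_cast h3
      omega
    · rw [covec_smul]; norm_num
  · exact ⟨1, by norm_num, by rw [mem_corootSet]; exact ⟨α, hα, h1, by simp⟩⟩

theorem indiv_reduced {Φ : Finset (V n)} (hΦ : IsCrystRS Φ) {α δ : V n} (hα : α ∈ Φ)
    (hδ : δ ∈ Φ) (iα : (1 / 2 : ℝ) • α ∉ Φ) (iδ : (1 / 2 : ℝ) • δ ∉ Φ) {c : ℝ}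
    (e : δ = c • α) : δ = α ∨ δ = -α := by
  have a0 := hΦ.ne_zero α hα
  have d0 := hΦ.ne_zero δ hδ
  have c0 : c ≠ 0 := by rintro rfl; simp at e; exact d0 e
  obtain ⟨p, hp⟩ := hΦ.cryst α hα δ hδ
  obtain ⟨q, hq⟩ := hΦ.cryst δ hδ α hα
  rw [e, real_inner_smul_left, inner_covec_self a0] at hp
  rw [e, covec_smul, real_inner_smul_right, inner_covec_self a0] at hq
  have hpq : (p * q : ℝ) = 4 := by
    rw [← hp, ← hq]; field_simp; norm_num
  have hpq' : p * q = 4 := by exact_mod_cast hpq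
  have hdvd : p ∣ 4 := ⟨q, hpq'.symm⟩
  have hb : p ≤ 4 := Int.le_of_dvd (by norm_num) hdvd
  have hb' : -4 ≤ p := by
    have := Int.le_of_dvd (by norm_num : (0 : ℤ) < 4) ((neg_dvd (a := p)).2 hdvd)
    omega
  have hcp : c = p / 2 := by linarith
  interval_cases p
  · exfalso; apply iδ
    have : (1 / 2 : ℝ) • δ = -α := by rw [e, hcp, smul_smul]; norm_num
    rw [this]; exact hΦ.neg_mem α hα
  · omega
  · right; rw [e, hcp]; norm_num
  · exfalso; apply iα
    have : (1 / 2 : ℝ) • α = -δ := by rw [e, hcp, ← neg_smul]; norm_num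
    rw [this]; exact hΦ.neg_mem δ hδ
  · omega
  · exfalso; apply iα
    have : (1 / 2 : ℝ) • α = δ := by rw [e, hcp]; norm_num
    rw [this]; exact hδ
  · left; rw [e, hcp]; norm_num
  · omega
  · exfalso; apply iδ
    have : (1 / 2 : ℝ) • δ = α := by rw [e, hcp, smul_smul]; norm_num
    rw [this]; exact hα

theorem coroot_neg {Φ : Finset (V n)} (hΦ : IsCrystRS Φ) :
    ∀ β ∈ corootSet Φ, -β ∈ corootSet Φ := by
  intro β hβ
  rw [mem_corootSet] at hβ ⊢
  obtain ⟨α, hα, iα, rfl⟩ := hβ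
  refine ⟨-α, hΦ.neg_mem α hα, fun h => iα ?_, (covec_neg α).symm⟩
  have := hΦ.neg_mem _ h
  rwa [smul_neg, neg_neg] at this

theorem coroot_refl {Φ : Finset (V n)} (hΦ : IsCrystRS Φ) :
    ∀ β ∈ corootSet Φ, ∀ γ ∈ corootSet Φ,
      ∃ k : ℤ, ⟪γ, covec β⟫ = (k : ℝ) ∧ γ - (k : ℝ) • β ∈ corootSet Φ := by
  intro β hβ γ hγ
  rw [mem_corootSet] at hβ hγ
  obtain ⟨α, hα, iα, rfl⟩ := hβ
  obtain ⟨δ, hδ, iδ, rfl⟩ := hγ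
  have a0 := hΦ.ne_zero α hα
  obtain ⟨k, hk⟩ := hΦ.cryst δ hδ α hα
  have hk' : ⟪covec δ, α⟫ = (k : ℝ) := by rw [real_inner_comm]; exact hk
  refine ⟨k, by rw [covec_covec a0, hk'], ?_⟩
  rw [mem_corootSet]
  refine ⟨δ - ⟪δ, covec α⟫ • α, hΦ.refl_mem α hα δ hδ, fun h => iδ ?_, ?_⟩
  · have h2 := hΦ.refl_mem α hα _ h
    have e : (1 / 2 : ℝ) • (δ - ⟪δ, covec α⟫ • α) -
        ⟪(1 / 2 : ℝ) • (δ - ⟪δ, covec α⟫ • α), covec α⟫ • α = (1 / 2 : ℝ) • δ := by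
      rw [real_inner_smul_left, inner_sub_left, real_inner_smul_left, inner_covec_self a0]
      module
    rwa [e] at h2
  · rw [covec_refl a0, hk']

theorem coroot_reduced {Φ : Finset (V n)} (hΦ : IsCrystRS Φ) :
    ∀ β ∈ corootSet Φ, ∀ γ ∈ corootSet Φ, ∀ c : ℝ, γ = c • β → γ = β ∨ γ = -β := by
  intro β hβ γ hγ c e
  rw [mem_corootSet] at hβ hγ
  obtain ⟨α, hα, iα, rfl⟩ := hβ
  obtain ⟨δ, hδ, iδ, rfl⟩ := hγ
  have e2 : δ = c⁻¹ • α := by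
    rw [← covec_covec (hΦ.ne_zero δ hδ), e, covec_smul, covec_covec (hΦ.ne_zero α hα)]
  rcases indiv_reduced hΦ hα hδ iα iδ e2 with h | h
  · left; rw [h]
  · right; rw [h, covec_neg]

theorem coroot_ne {Φ Δ : Finset (V n)} (hΦ : IsCrystRS Φ) (hΔ : IsSimpleSys Φ Δ) {v : V n}
    (hv : ∀ d ∈ Δ, ⟪v, covec d⟫ = 1) : ∀ β ∈ corootSet Φ, ⟪v, β⟫ ≠ 0 := by
  intro β hβ
  rw [mem_corootSet] at hβ
  obtain ⟨α, hα, iα, rfl⟩ := hβ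
  have := inner_self_pos (hΦ.ne_zero α hα)
  rw [covec, real_inner_smul_right]
  exact mul_ne_zero (by positivity) (root_ne hΦ hΔ hv hα)

theorem pos_simple_multiple {Φ Δ : Finset (V n)} (hΔ : IsSimpleSys Φ Δ)
    {α d : V n} (hd : d ∈ Δ) (hp : IsPosRoot Δ α) {m : ℝ} (hn : IsPosRoot Δ (-(α - m • d))) :
    ∃ c : ℝ, α = c • d := by
  classical
  obtain ⟨c, hc, e⟩ := hp
  obtain ⟨c', hc', e'⟩ := hn
  refine ⟨c d, ?_⟩
  rw [e]
  have hz : ∀ b ∈ Δ, b ≠ d → c b = 0 := by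
    intro b hb hbd
    obtain ⟨w, hw⟩ := dual_vec hΔ (fun x => if x = b then 1 else 0)
    have key : ∀ c : V n → ℝ, ⟪w, ∑ d ∈ Δ, c d • d⟫ = c b := by
      intro c
      rw [inner_sum, Finset.sum_eq_single b]
      · rw [real_inner_smul_right, hw b hb]; simp
      · intro x hx hxb
        rw [real_inner_smul_right, hw x hx]; simp [hxb]
      · intro h; exact absurd hb h
    have h1 : ⟪w, α⟫ = c b := by rw [e]; exact key c
    have h2 : ⟪w, -(α - m • d)⟫ = c' b := by rw [e']; exact key c'
    rw [inner_neg_right, inner_sub_right, real_inner_smul_right, hw d hd, h1,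
      if_neg (Ne.symm hbd)] at h2
    have := hc b hb
    have := hc' b hb
    linarith
  exact Finset.sum_eq_single d (fun b hb hbd => by rw [hz b hb hbd, zero_smul])
    (fun h => absurd hd h)

theorem coroot_int {Φ Δ : Finset (V n)} (hΦ : IsCrystRS Φ) (hΔ : IsSimpleSys Φ Δ) {v : V n}
    (hv : ∀ d ∈ Δ, ⟪v, covec d⟫ = 1) : ∀ β ∈ corootSet Φ, ∃ k : ℤ, ⟪v, β⟫ = (k : ℝ) := by
  classical
  by_contra hcon
  push Not at hcon
  obtain ⟨β₀, hβ₀, hn₀⟩ := hcon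
  set B := (corootSet Φ).filter (fun β => 0 < ⟪v, β⟫ ∧ ∀ k : ℤ, ⟪v, β⟫ ≠ (k : ℝ)) with hB
  have hBne : B.Nonempty := by
    rcases lt_or_gt_of_ne (coroot_ne hΦ hΔ hv β₀ hβ₀) with h | h
    · refine ⟨-β₀, Finset.mem_filter.2 ⟨coroot_neg hΦ β₀ hβ₀, ?_, fun k hk => hn₀ (-k) ?_⟩⟩
      · rw [inner_neg_right]; linarith
      · rw [inner_neg_right] at hk; push_cast; linarith
    · exact ⟨β₀, Finset.mem_filter.2 ⟨hβ₀, h, hn₀⟩⟩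
  obtain ⟨β, hβB, hmin⟩ := Finset.exists_min_image B (fun β => ⟪v, β⟫) hBne
  obtain ⟨hβ, hpos, hnint⟩ := Finset.mem_filter.1 hβB
  obtain ⟨α, hα, iα, rfl⟩ := mem_corootSet.1 hβ
  have a0 := hΦ.ne_zero α hα
  have aa := inner_self_pos a0
  have hP : IsPosRoot Δ α := (posRoot_iff hΦ hΔ hv hα).2 ((covec_pos_iff a0).1 hpos)
  have hex : ∃ d ∈ Δ, 0 < ⟪α, d⟫ := by
    by_contra hn
    push Not at hn
    obtain ⟨c, hc, e⟩ := hP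
    have h1 : ⟪α, α⟫ = ∑ d ∈ Δ, c d * ⟪α, d⟫ := by
      conv_lhs => rw [e, inner_sum]
      rw [← e]
      simp only [real_inner_smul_right]
    have h2 : ∑ d ∈ Δ, c d * ⟪α, d⟫ ≤ 0 :=
      Finset.sum_nonpos (fun d hd => mul_nonpos_of_nonneg_of_nonpos (hc d hd) (hn d hd))
    linarith
  obtain ⟨d, hd, had⟩ := hex
  have hdΦ := hΔ.subset hd
  have d0 := hΦ.ne_zero d hdΦ
  have dd := inner_self_pos d0
  obtain ⟨t, ht, hγ⟩ := exists_indiv hΦ hdΦ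
  have ht' : (0 : ℝ) < t := by exact_mod_cast ht
  have hvγ : ⟪v, (t : ℝ) • covec d⟫ = t := by
    rw [real_inner_smul_right, hv d hd, mul_one]
  obtain ⟨k, hk, hmem⟩ := coroot_refl hΦ _ hγ _ hβ
  have hkpos : (0 : ℝ) < k := by
    rw [← hk, covec_smul, covec_covec d0, covec, real_inner_smul_left, real_inner_smul_right]
    positivity
  have hval : ⟪v, covec α - (k : ℝ) • (t : ℝ) • covec d⟫ = ⟪v, covec α⟫ - k * t := by
    rw [inner_sub_right, real_inner_smul_right, hvγ]
  rcases lt_or_gt_of_ne (coroot_ne hΦ hΔ hv _ hmem) with h | h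
  · have href := hΦ.refl_mem d hdΦ α hα
    have hcr : covec (α - ⟪α, covec d⟫ • d) = covec α - (k : ℝ) • (t : ℝ) • covec d := by
      rw [covec_refl d0, smul_smul]
      congr 2
      rw [← hk, covec_smul, covec_covec d0, real_inner_smul_right]
      field_simp
    have hneg : IsPosRoot Δ (-(α - ⟪α, covec d⟫ • d)) := by
      rcases root_cases hΔ href with h' | h'
      · exfalso
        have h3 := posRoot_pos hΦ hΔ hv (hΦ.ne_zero _ href) h'
        rw [← covec_pos_iff (hΦ.ne_zero _ href), hcr] at h3
        linarith
      · exact h'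
    obtain ⟨c, hc⟩ := pos_simple_multiple hΔ hd hP hneg
    have hmul : covec α = (c⁻¹ * (t : ℝ)⁻¹) • ((t : ℝ) • covec d) := by
      rw [hc, covec_smul, smul_smul, mul_assoc, inv_mul_cancel₀ ht'.ne', mul_one]
    rcases coroot_reduced hΦ _ hγ _ hβ _ hmul with h' | h'
    · exact hnint t (by rw [h', hvγ])
    · exact hnint (-t) (by rw [h', inner_neg_right, hvγ]; push_cast; rfl)
  · have hmemB : covec α - (k : ℝ) • (t : ℝ) • covec d ∈ B := by
      refine Finset.mem_filter.2 ⟨hmem, h, fun l hl => hnint (l + k * t) ?_⟩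
      rw [hval] at hl
      push_cast
      linarith
    have := hmin _ hmemB
    simp only [hval] at this
    have : 0 < (k : ℝ) * t := mul_pos hkpos ht'
    linarith

theorem root_geo {Φ Δ : Finset (V n)} (hΦ : IsCrystRS Φ) (hΔ : IsSimpleSys Φ Δ) {v : V n}
    (hv : ∀ d ∈ Δ, ⟪v, covec d⟫ = 1) : GeoData (corootSet Φ) v :=
  ⟨coroot_neg hΦ, coroot_refl hΦ, coroot_reduced hΦ, coroot_int hΦ hΔ hv, coroot_ne hΦ hΔ hv⟩

theorem exists_height {Φ Δ : Finset (V n)} (hΦ : IsCrystRS Φ) (hΔ : IsSimpleSys Φ Δ) :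
    ∃ v : V n, ∀ d ∈ Δ, ⟪v, covec d⟫ = 1 := by
  obtain ⟨v, hv⟩ := dual_vec hΔ (fun d => ⟪d, d⟫ / 2)
  refine ⟨v, fun d hd => ?_⟩
  have := inner_self_pos (hΦ.ne_zero d (hΔ.subset hd))
  rw [covec, real_inner_smul_right, hv d hd]
  field_simp

theorem simple_isPos {Δ : Finset (V n)} {d : V n} (hd : d ∈ Δ) : IsPosRoot Δ d := by
  classical
  refine ⟨fun x => if x = d then 1 else 0, fun x _ => by dsimp only; split_ifs <;> norm_num, ?_⟩
  rw [Finset.sum_eq_single d]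
  · simp
  · intro b _ hb; simp [hb]
  · intro h; exact absurd hd h

section Shi

theorem region_inBox {Φ Δ Plus : Finset (V n)} (hΦ : IsCrystRS Φ)
    (hΔ : IsSimpleSys Φ Δ) (hPlus : ∀ α, α ∈ Plus ↔ α ∈ Φ ∧ IsPosRoot Δ α)
    {v : V n} (hv : ∀ d ∈ Δ, ⟪v, covec d⟫ = 1) {k : V n → ℤ} (hk : ∀ α ∈ Δ, k α = 0) {x : V n}
    (hx : x ∈ shiRegion Plus k) : InBox (corootSet Φ) v x := by
  refine ⟨?_, ?_⟩
  · have key : ∀ α ∈ Plus, ∀ l : ℤ, ⟪x, covec α⟫ ≠ (l : ℝ) := by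
      intro α hα l e
      obtain ⟨h1, h2⟩ := hx α hα
      rw [e] at h1 h2
      have h1' : k α < l := by exact_mod_cast h1
      have h2' : l < k α + 1 := by exact_mod_cast h2
      omega
    rintro h ⟨β, hβ, l, rfl⟩ e
    obtain ⟨α, hα, iα, rfl⟩ := mem_corootSet.1 hβ
    rw [sub_eq_zero] at e
    rcases root_cases hΔ hα with h' | h'
    · exact key α ((hPlus α).2 ⟨hα, h'⟩) l e
    · refine key (-α) ((hPlus _).2 ⟨hΦ.neg_mem α hα, h'⟩) (-l) ?_
      rw [covec_neg, inner_neg_right, e]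
      push_cast; rfl
  · intro β hβ hpos
    obtain ⟨α, hα, iα, rfl⟩ := mem_corootSet.1 hβ
    have a0 := hΦ.ne_zero α hα
    have aa := inner_self_pos a0
    have hP : IsPosRoot Δ α := (posRoot_iff hΦ hΔ hv hα).2 ((covec_pos_iff a0).1 hpos)
    obtain ⟨c, hc, e⟩ := hP
    have hexp : ∀ y : V n, ⟪y, covec α⟫ =
        ∑ d ∈ Δ, (2 / ⟪α, α⟫ * c d * (⟪d, d⟫ / 2)) * ⟪y, covec d⟫ := by
      intro y
      have h1 : ⟪y, α⟫ = ∑ d ∈ Δ, c d * ⟪y, d⟫ := by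
        conv_lhs => rw [e, inner_sum]
        simp only [real_inner_smul_right]
      conv_lhs => rw [covec, real_inner_smul_right, h1, Finset.mul_sum]
      apply Finset.sum_congr rfl
      intro d hd
      have dd := inner_self_pos (hΦ.ne_zero d (hΔ.subset hd))
      rw [show ⟪y, covec d⟫ = 2 / ⟪d, d⟫ * ⟪y, d⟫ by rw [covec, real_inner_smul_right]]
      field_simp
    have hex : ∃ d ∈ Δ, 0 < c d := by
      by_contra hn
      push Not at hn
      apply a0
      rw [e]
      apply Finset.sum_eq_zero
      intro d hd
      rw [le_antisymm (hn d hd) (hc d hd), zero_smul]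
    obtain ⟨d₀, hd₀, hc₀⟩ := hex
    have hsm : ∀ d ∈ Δ, 0 < ⟪x, covec d⟫ ∧ ⟪x, covec d⟫ < 1 := by
      intro d hd
      have := hx d ((hPlus d).2 ⟨hΔ.subset hd, simple_isPos hd⟩)
      rw [hk d hd] at this
      simpa using this
    have hnn : ∀ d ∈ Δ, 0 ≤ 2 / ⟪α, α⟫ * c d * (⟪d, d⟫ / 2) := by
      intro d hd
      have dd := inner_self_pos (hΦ.ne_zero d (hΔ.subset hd))
      have := hc d hd
      positivity
    have hnp : 0 < 2 / ⟪α, α⟫ * c d₀ * (⟪d₀, d₀⟫ / 2) := by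
      have dd := inner_self_pos (hΦ.ne_zero d₀ (hΔ.subset hd₀))
      positivity
    rw [hexp x, hexp v]
    constructor
    · exact Finset.sum_pos' (fun d hd => mul_nonneg (hnn d hd) (hsm d hd).1.le)
        ⟨d₀, hd₀, mul_pos hnp (hsm d₀ hd₀).1⟩
    · apply Finset.sum_lt_sum
      · intro d hd
        rw [hv d hd]
        exact mul_le_mul_of_nonneg_left (hsm d hd).2.le (hnn d hd)
      · refine ⟨d₀, hd₀, ?_⟩
        rw [hv d₀ hd₀]
        exact mul_lt_mul_of_pos_left (hsm d₀ hd₀).2 hnp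

theorem region_le {Φ Δ Plus : Finset (V n)} (hΦ : IsCrystRS Φ)
    (hΔ : IsSimpleSys Φ Δ) (hPlus : ∀ α, α ∈ Plus ↔ α ∈ Φ ∧ IsPosRoot Δ α)
    {v : V n} (hv : ∀ d ∈ Δ, ⟪v, covec d⟫ = 1) {k l : V n → ℤ} {x y : V n} (hx : x ∈ shiRegion Plus k)
    (hy : y ∈ shiRegion Plus l) :
    PLe (corootSet Φ) v x y ↔ ∀ α ∈ Plus, k α ≤ l α := by
  constructor
  · intro h α hα
    have hα' := (hPlus α).1 hα
    obtain ⟨t, ht, hmem⟩ := exists_indiv hΦ hα'.1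
    have ht' : (0 : ℝ) < t := by exact_mod_cast ht
    have h1 := h (fun x => ⟪x, (t : ℝ) • covec α⟫ - ((t * k α : ℤ) : ℝ)) ⟨_, hmem, _, rfl⟩ (by
      rw [slp_mk, real_inner_smul_right]
      exact mul_pos ht' ((covec_pos_iff (hΦ.ne_zero α hα'.1)).2
        ((posRoot_iff hΦ hΔ hv hα'.1).1 hα'.2))) (by
      have := (hx α hα).1
      rw [real_inner_smul_right]
      push_cast
      nlinarith)
    rw [real_inner_smul_right] at h1
    push_cast at h1
    have h2 := (hy α hα).2
    have h3 : (k α : ℝ) < l α + 1 := by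
      have : (k α : ℝ) < ⟪y, covec α⟫ := by
        by_contra hc
        nlinarith
      linarith
    have h4 : k α < l α + 1 := by exact_mod_cast h3
    omega
  · rintro h g ⟨β, hβ, q, rfl⟩ hs hpos
    rw [slp_mk] at hs
    obtain ⟨α, hα, iα, rfl⟩ := mem_corootSet.1 hβ
    have hP : α ∈ Plus := (hPlus α).2 ⟨hα,
      (posRoot_iff hΦ hΔ hv hα).2 ((covec_pos_iff (hΦ.ne_zero α hα)).1 hs)⟩
    have h1 := (hx α hP).2
    have h2 := (hy α hP).1
    have h3 : (q : ℝ) < k α + 1 := by linarith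
    have h4 : q < k α + 1 := by exact_mod_cast h3
    have h5 : q ≤ l α := by have := h α hP; omega
    have h6 : (q : ℝ) ≤ l α := by exact_mod_cast h5
    linarith

theorem exists_shi {Φ Δ Plus : Finset (V n)} (hΦ : IsCrystRS Φ)
    (hΔ : IsSimpleSys Φ Δ) (hPlus : ∀ α, α ∈ Plus ↔ α ∈ Φ ∧ IsPosRoot Δ α)
    {v : V n} (hv : ∀ d ∈ Δ, ⟪v, covec d⟫ = 1) (x : Pt (corootSet Φ) v) :
    ∃ k : V n → ℤ, IsAdmitted Δ Plus k ∧ x.1 ∈ shiRegion Plus k ∧ ∀ α ∉ Plus, k α = 0 := by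
  classical
  have hmem : x.1 ∈ shiRegion Plus
      (fun α => if α ∈ Plus then ⌊⟪x.1, covec α⟫⌋ else 0) := by
    intro α hα
    simp only [hα, if_true]
    refine ⟨lt_of_le_of_ne (Int.floor_le _) (fun e => ?_), Int.lt_floor_add_one _⟩
    obtain ⟨t, ht, hmem⟩ := exists_indiv hΦ ((hPlus α).1 hα).1
    refine x.2.1 _ ⟨_, hmem, t * ⌊⟪x.1, covec α⟫⌋, rfl⟩ ?_
    rw [real_inner_smul_right]
    push_cast
    rw [e]
    exact sub_self _
  refine ⟨_, ⟨⟨x.1, hmem⟩, ?_⟩, hmem, fun α hα => if_neg hα⟩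
  intro d hd
  have hdP : d ∈ Plus := (hPlus d).2 ⟨hΔ.subset hd, simple_isPos hd⟩
  simp only [hdP, if_true]
  obtain ⟨t, ht, hm⟩ := exists_indiv hΦ (hΔ.subset hd)
  have ht' : (0 : ℝ) < t := by exact_mod_cast ht
  have h1 := x.2.2 _ hm (by rw [real_inner_smul_right, hv d hd, mul_one]; exact ht')
  rw [real_inner_smul_right, real_inner_smul_right, hv d hd] at h1
  rw [Int.floor_eq_zero_iff]
  constructor
  · by_contra hc
    nlinarith [h1.1]
  · by_contra hc
    nlinarith [h1.2]

theorem shi_semidistrib {Φ Δ Plus : Finset (V n)} (hΦ : IsCrystRS Φ)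
    (hΔ : IsSimpleSys Φ Δ) (hPlus : ∀ α, α ∈ Plus ↔ α ∈ Φ ∧ IsPosRoot Δ α)
    {v : V n} (hv : ∀ d ∈ Δ, ⟪v, covec d⟫ = 1) :
    IsSemidistribLattice
      (fun lam gam : {k : V n → ℤ // IsAdmitted Δ Plus k} =>
        ∀ α ∈ Plus, lam.1 α ≤ gam.1 α) := by
  have D := root_geo hΦ hΔ hv
  letI := ptBounded D
  haveI := pt_wf_lt D
  haveI := pt_wf_gt D
  have hA := pt_half D
  have hA' : HalfCond (Pt (corootSet Φ) v)ᵒᵈ := HalfCond.of_orderIso (dualIso D) hA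
  let f : {k : V n → ℤ // IsAdmitted Δ Plus k} → Pt (corootSet Φ) v := fun k =>
    ⟨k.2.1.some, region_inBox hΦ hΔ hPlus hv k.2.2 k.2.1.some_mem⟩
  have hf : ∀ k, (f k).1 ∈ shiRegion Plus k.1 := fun k => k.2.1.some_mem
  choose g₀ hg₁ hg₂ hg₃ using exists_shi hΦ hΔ hPlus hv
  let g : Pt (corootSet Φ) v → {k : V n → ℤ // IsAdmitted Δ Plus k} := fun x => ⟨g₀ x, hg₁ x⟩
  refine semidistrib_of_half hA hA' _ f g ?_ ?_ ?_ ?_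
  · intro x y
    exact (region_le hΦ hΔ hPlus hv (hf x) (hf y)).symm
  · intro q
    exact (region_le hΦ hΔ hPlus hv (hf (g q)) (hg₂ q)).2 (fun _ _ => le_rfl)
  · intro q
    exact (region_le hΦ hΔ hPlus hv (hg₂ q) (hf (g q))).2 (fun _ _ => le_rfl)
  · intro p q hpq hqp
    apply Subtype.ext
    funext α
    change g₀ p α = g₀ q α
    by_cases hα : α ∈ Plus
    · exact le_antisymm ((region_le hΦ hΔ hPlus hv (hg₂ p) (hg₂ q)).1 hpq α hα)
        ((region_le hΦ hΔ hPlus hv (hg₂ q) (hg₂ p)).1 hqp α hα)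
    · rw [hg₃ p α hα, hg₃ q α hα]

end Shi

end Roots

/-- every interval in the right weak order of a Coxeter group is a
semidistributive lattice; consequently, the poset of admitted vectors (i.e. of irreducible
components `H⁰(X̂_{W_a})` of the Shi variety, ordered componentwise) — which forms an interval
`[e, w_max]` in the weak order of the affine Weyl group — is a semidistributive lattice. -/
theorem components_semidistributive_lattice
    {B W : Type*} [Group W] {M : CoxeterMatrix B} (cs : CoxeterSystem M W) (a b : W)
    (hab : weakLe cs a b)
    {n : ℕ} (Φ Δ Plus : Finset (V n)) (hΦ : IsCrystRS Φ)
    (hΔ : IsSimpleSys Φ Δ) (hPlus : ∀ α, α ∈ Plus ↔ α ∈ Φ ∧ IsPosRoot Δ α) :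
    IsSemidistribLattice
      (fun u v : {w : W // weakLe cs a w ∧ weakLe cs w b} => weakLe cs u.1 v.1) ∧
    IsSemidistribLattice
      (fun lam gam : {k : V n → ℤ // IsAdmitted Δ Plus k} =>
        ∀ α ∈ Plus, lam.1 α ≤ gam.1 α) := by
  obtain ⟨v, hv⟩ := exists_height hΦ hΔ
  exact ⟨weak_interval_semidistrib cs a b hab, shi_semidistrib hΦ hΔ hPlus hv⟩
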